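/- arXiv:1910.09837 — 2 statements merged into one kernel-verified Lean document; each statement's English description precedes it below -/
import Mathlib

section
/- Let 0 < a ≤ 1/2 with a ≠ 1/4, and set a⋆ := min(a, 1−a). There exist positive constants C₁(a), C₂(a), k₀(a), t₀(a) such that for all real k ≥ k₀(a) and t ≥ t₀(a) with t > k, ∫_{t−k}^{t+k} |Q(1/2 + iv, a)| dv ≥ 2k·|cos(2πa)| − C₁(a) − C₂(a)·k²/(t−k)^{1/2} − | Σ_{a_* ∈ {a, 1−a}} Σ_{2 ≤ n < t/a⋆} ( sin(k·log(n+a_*)) / ((n+a_*)^{1/2+it} · log(n+a_*)) + e^{2πi a_* n} · sin(k·log n) / (n^{1/2+it} · log n) ) |. -/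
open Complex MeasureTheory

/-- The Hurwitz zeta function `ζ(s, a)`. -/
noncomputable def hzeta (a : ℝ) (s : ℂ) : ℂ := HurwitzZeta.hurwitzZeta (a : UnitAddCircle) s

/-- The periodic (exponential) zeta function `Li(s, a)`. -/
noncomputable def pzeta (a : ℝ) (s : ℂ) : ℂ := HurwitzZeta.expZeta (a : UnitAddCircle) s

/-- The quadrilateral zeta function `Q(s, a)`, defined by
`2Q(s,a) = ζ(s,a) + ζ(s,1−a) + Li(s,a) + Li(s,1−a)`. -/
noncomputable def Qzeta (s : ℂ) (a : ℝ) : ℂ :=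
  (hzeta a s + hzeta (1 - a) s + pzeta a s + pzeta (1 - a) s) / 2

/-- The Dirichlet-polynomial sum `Σ_{2 ≤ n < t/a⋆} ( sin(k log(n+a_*)) / ((n+a_*)^{1/2+it} log(n+a_*))
+ e^{2πi a_* n} sin(k log n) / (n^{1/2+it} log n) )`. -/
noncomputable def Ssum (astar amin k t : ℝ) : ℂ :=
  ∑ n ∈ Finset.Ico 2 ⌈t / amin⌉₊,
    ((Real.sin (k * Real.log (n + astar)) : ℂ) /
        (((n : ℝ) + astar : ℝ) ^ ((1 : ℂ) / 2 + Complex.I * t) * (Real.log (n + astar) : ℂ)) +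
      Complex.exp (2 * Real.pi * Complex.I * astar * n) * (Real.sin (k * Real.log n) : ℂ) /
        ((n : ℂ) ^ ((1 : ℂ) / 2 + Complex.I * t) * (Real.log n : ℂ)))

noncomputable def PP (x : ℝ) (s : ℂ) : ℂ := cexp (-s * (Real.log x : ℂ))

lemma PP_norm {x : ℝ} (hx : 0 < x) (s : ℂ) : ‖PP x s‖ = x ^ (-s.re) := by
  rw [PP, Complex.norm_exp, Real.rpow_def_of_pos hx]
  congr 1
  simp [Complex.mul_re, mul_comm]

lemma PP_cpow {x : ℝ} (hx : 0 < x) (s : ℂ) : (x : ℂ) ^ (-s) = PP x s := by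
  rw [PP, Complex.cpow_def_of_ne_zero (by exact_mod_cast hx.ne'), Complex.ofReal_log hx.le, mul_comm]

lemma PP_inv {x : ℝ} (hx : 0 < x) (s : ℂ) : 1 / (x : ℂ) ^ s = PP x s := by
  rw [← PP_cpow hx, Complex.cpow_neg, one_div]

lemma PP_mul {x : ℝ} (hx : 0 < x) (s : ℂ) : (x : ℂ) * PP x (s + 1) = PP x s := by
  have : (x : ℂ) = cexp (Real.log x : ℂ) := by
    rw [← Complex.ofReal_exp, Real.exp_log hx]
  nth_rewrite 1 [this]
  rw [PP, PP, ← Complex.exp_add]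
  congr 1; ring

lemma PP_deriv {x : ℝ} (hx : 0 < x) (s : ℂ) :
    HasDerivAt (fun y : ℝ => PP y s) (-s * PP x (s + 1)) x := by
  have h := ((Real.hasDerivAt_log hx.ne').ofReal_comp.const_mul (-s)).cexp
  refine h.congr_deriv ?_
  have hx' : (x : ℂ) ≠ 0 := by exact_mod_cast hx.ne'
  rw [show cexp (-s * (Real.log x : ℂ)) = PP x s from rfl, ← PP_mul hx s]
  push_cast
  field_simp

lemma PP_shift {x : ℝ} (hx : 0 < x) (s : ℂ) (u : ℝ) (hu : 0 ≤ u) :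
    HasDerivAt (fun y : ℝ => PP (x + y) s) (-s * PP (x + u) (s + 1)) u := by
  exact HasDerivAt.comp_const_add x u (PP_deriv (by linarith) s)

lemma PP_cont {x : ℝ} (hx : 0 < x) (s : ℂ) : ContinuousOn (fun u : ℝ => PP (x + u) s) (Set.Icc 0 1) :=
  fun u hu => (PP_shift hx s u hu.1).continuousAt.continuousWithinAt

lemma PP_diff (x : ℝ) : Differentiable ℂ (fun s => PP x s) := by
  unfold PP; fun_prop

lemma PP_int1 {x : ℝ} (hx : 0 < x) (s : ℂ) :
    PP (x + 1) s - PP x s = -s * ∫ u in (0:ℝ)..1, ((fun _ => 1 : ℝ → ℝ) u : ℂ) * PP (x + u) (s + 1) := by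
  have := intervalIntegral.integral_eq_sub_of_hasDerivAt (a := 0) (b := 1)
    (f := fun y : ℝ => PP (x + y) s) (f' := fun u => -s * PP (x + u) (s + 1))
    (fun u hu => PP_shift hx s u (by rw [Set.uIcc_of_le zero_le_one] at hu; exact hu.1))
    (by
      apply ContinuousOn.intervalIntegrable
      rw [Set.uIcc_of_le zero_le_one]
      exact continuousOn_const.mul (PP_cont hx _))
  rw [intervalIntegral.integral_const_mul] at this
  simp only [ofReal_one, one_mul]
  rw [this]; simp

noncomputable def FF (x : ℝ) (s : ℂ) : ℂ := PP x (s - 1) / (s - 1)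

lemma PP_int2 {x : ℝ} (hx : 0 < x) (s : ℂ) (hs : s ≠ 1) :
    PP x s - FF x s + FF (x + 1) s =
      s * ∫ u in (0:ℝ)..1, ((fun u => 1 - u : ℝ → ℝ) u : ℂ) * PP (x + u) (s + 1) := by
  have hs' : s - 1 ≠ 0 := sub_ne_zero.mpr hs
  have := intervalIntegral.integral_eq_sub_of_hasDerivAt (a := 0) (b := 1)
    (f := fun y : ℝ => -(((1 - y : ℝ) : ℂ) * PP (x + y) s) + FF (x + y) s)
    (f' := fun u => s * (((1 - u : ℝ) : ℂ) * PP (x + u) (s + 1)))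
    (fun u hu => by
      rw [Set.uIcc_of_le zero_le_one] at hu
      have h1 := PP_shift hx s u hu.1
      have h2 := (PP_shift hx (s - 1) u hu.1).div_const (s - 1)
      have h3 : HasDerivAt (fun y : ℝ => ((1 - y : ℝ) : ℂ)) (((-1 : ℝ)) : ℂ) u :=
        ((hasDerivAt_id u).const_sub 1).ofReal_comp
      refine ((h3.mul h1).neg.add h2).congr_deriv ?_
      rw [sub_add_cancel]
      push_cast
      field_simp
      ring)
    (by
      apply ContinuousOn.intervalIntegrable
      rw [Set.uIcc_of_le zero_le_one]
      exact continuousOn_const.mul ((by fun_prop : Continuous fun u : ℝ => ((1 - u : ℝ) : ℂ)).continuousOn.mul (PP_cont hx _)))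
  rw [intervalIntegral.integral_const_mul] at this
  rw [this]; simp; ring

lemma PP_int_bound {x : ℝ} (hx : 0 < x) (s : ℂ) (hs : 0 ≤ s.re + 1) (ψ : ℝ → ℝ)
    (hψ : ∀ u ∈ Set.Icc (0:ℝ) 1, |ψ u| ≤ 1) :
    ‖∫ u in (0:ℝ)..1, (ψ u : ℂ) * PP (x + u) (s + 1)‖ ≤ x ^ (-(s.re + 1)) := by
  have := intervalIntegral.norm_integral_le_of_norm_le_const (a := 0) (b := 1)
    (f := fun u : ℝ => (ψ u : ℂ) * PP (x + u) (s + 1)) (C := x ^ (-(s.re + 1))) (by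
      intro u hu
      rw [Set.uIoc_of_le zero_le_one] at hu
      rw [norm_mul, Complex.norm_real, PP_norm (by linarith [hu.1])]
      have h1 := hψ u ⟨hu.1.le, hu.2⟩
      have h2 : (x + u) ^ (-(s + 1).re) ≤ x ^ (-(s.re + 1)) := by
        rw [Complex.add_re, Complex.one_re]
        exact Real.rpow_le_rpow_of_nonpos hx (by linarith [hu.1]) (by linarith)
      have h3 : 0 ≤ (x + u) ^ (-(s + 1).re) := Real.rpow_nonneg (by linarith [hu.1]) _
      rw [Real.norm_eq_abs]
      calc _ ≤ 1 * (x + u) ^ (-(s + 1).re) := by gcongr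
        _ ≤ _ := by linarith)
  simpa using this

/-- analytic continuation -/
lemma cont_lemma (f : ℂ → ℂ) (hf : ∀ s : ℂ, 0 < s.im → DifferentiableAt ℂ f s) (g : ℕ → ℂ → ℂ)
    (hg : ∀ n (s : ℂ), 0 < s.im → DifferentiableAt ℂ (g n) s) (β : ℝ) (hβ : 1 ≤ β) (C : ℝ) (hC : 0 ≤ C)
    (hb : ∀ n (s : ℂ), 0 < s.re → 0 < s.im → ‖g n s‖ ≤ C * ‖s‖ * (n + β) ^ (-(s.re + 1)))
    (h1 : ∀ s : ℂ, 1 < s.re → 0 < s.im → Summable (fun n => g n s) → HasSum (fun n => g n s) (f s))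
    (s : ℂ) (hs : 1 / 4 < s.re) (hs' : 0 < s.im) : HasSum (fun n => g n s) (f s) := by
  have hsum : Summable (fun n : ℕ => ((n : ℝ) + β) ^ (-(5/4) : ℝ)) := by
    have h0 : Summable (fun n : ℕ => ((n + 1 : ℕ) : ℝ) ^ (-(5/4) : ℝ)) :=
      (summable_nat_add_iff 1).mpr (Real.summable_nat_rpow.mpr (by norm_num))
    refine Summable.of_nonneg_of_le (fun n => by positivity) (fun n => ?_) h0
    apply Real.rpow_le_rpow_of_nonpos (by positivity) (by push_cast; linarith) (by norm_num)
  set R : ℝ := ‖s‖ + ‖(2 + s.im * I : ℂ)‖ + 1 with hR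
  let U : Set ℂ := ({z | 1/4 < z.re} ∩ {z | 0 < z.im}) ∩ Metric.ball 0 R
  have hUo : IsOpen U := ((isOpen_lt continuous_const Complex.continuous_re).inter
    (isOpen_lt continuous_const Complex.continuous_im)).inter Metric.isOpen_ball
  have hUc : Convex ℝ U := ((convex_halfSpace_re_gt _).inter (convex_halfSpace_im_gt _)).inter
    (convex_ball _ _)
  have hbU : ∀ n, ∀ z ∈ U, ‖g n z‖ ≤ C * R * ((n : ℝ) + β) ^ (-(5/4) : ℝ) := by
    rintro n z ⟨⟨hz1, hz2⟩, hz3⟩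
    simp only [Set.mem_ofPred_eq] at hz1 hz2
    have hz3' : ‖z‖ < R := by simpa using hz3
    refine (hb n z (by linarith) hz2).trans ?_
    have : ((n : ℝ) + β) ^ (-(z.re + 1)) ≤ ((n : ℝ) + β) ^ (-(5/4) : ℝ) :=
      Real.rpow_le_rpow_of_exponent_le (by have : (0:ℝ) ≤ n := n.cast_nonneg
                                           linarith) (by linarith)
    gcongr
  have hsU : Summable (fun n : ℕ => C * R * ((n : ℝ) + β) ^ (-(5/4) : ℝ)) := hsum.mul_left _
  have hSm : ∀ z ∈ U, Summable (fun n => g n z) := fun z hz =>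
    Summable.of_norm_bounded hsU (fun n => hbU n z hz)
  have hd : DifferentiableOn ℂ (fun z => ∑' n, g n z) U :=
    differentiableOn_tsum_of_summable_norm hsU
      (fun n z hz => (hg n z hz.1.2).differentiableWithinAt) hUo hbU
  have hfd : DifferentiableOn ℂ f U := fun z hz => (hf z hz.1.2).differentiableWithinAt
  have hsin : s ∈ U := ⟨⟨hs, hs'⟩, by
    rw [mem_ball_zero_iff, hR]
    have := norm_nonneg (2 + s.im * I : ℂ)
    linarith⟩
  have hz0 : (2 + s.im * I : ℂ) ∈ U := by
    refine ⟨⟨by simp; norm_num, by simpa using hs'⟩, ?_⟩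
    rw [mem_ball_zero_iff, hR]
    have := norm_nonneg s
    linarith
  have heq : Set.EqOn (fun z => ∑' n, g n z) f U := by
    refine (hd.analyticOnNhd hUo).eqOn_of_preconnected_of_eventuallyEq (hfd.analyticOnNhd hUo)
      hUc.isPreconnected hz0 ?_
    have hV : IsOpen (U ∩ {z | 1 < z.re}) := hUo.inter (isOpen_lt continuous_const Complex.continuous_re)
    filter_upwards [hV.mem_nhds ⟨hz0, by simp⟩] with z hz
    exact (h1 z hz.2 hz.1.1.2 (hSm z hz.1)).tsum_eq
  have := (hSm s hsin).hasSum
  rwa [show ∑' n, g n s = f s from heq hsin] at this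


lemma abel_id (h q c : ℕ → ℂ) (hq : ∀ n, h (n + 1) = h n * q n) (N M : ℕ) (hNM : N ≤ M)
    (hc : ∀ n, N ≤ n → c n * (1 - q n) = 1) :
    ∑ n ∈ Finset.Ico N M, h n = h N * c N - h M * c M +
      ∑ n ∈ Finset.Ico N M, h (n + 1) * (c (n + 1) - c n) := by
  induction M, hNM using Nat.le_induction with
  | base => simp
  | succ m hm ih =>
    rw [Finset.sum_Ico_succ_top hm, Finset.sum_Ico_succ_top hm, ih]
    have := hc m hm
    rw [hq m]
    linear_combination (-h m) * this

lemma rpow_step {x : ℝ} (hx : 0 < x) :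
    (x + 1) ^ (-(3/2) : ℝ) ≤ 2 * ((Real.sqrt x)⁻¹ - (Real.sqrt (x + 1))⁻¹) := by
  have h1 : (x + 1) ^ (-(3/2) : ℝ) = (Real.sqrt (x+1))⁻¹ ^ 3 := by
    rw [Real.sqrt_eq_rpow, ← Real.rpow_neg (by linarith), ← Real.rpow_natCast, ← Real.rpow_mul (by linarith)]
    norm_num
  rw [h1]
  have hp : 0 < Real.sqrt x := Real.sqrt_pos.mpr hx
  have hq : 0 < Real.sqrt (x+1) := Real.sqrt_pos.mpr (by linarith)
  have e1 := Real.sq_sqrt hx.le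
  have e2 := Real.sq_sqrt (show 0 ≤ x + 1 by linarith)
  set p := Real.sqrt x
  set q := Real.sqrt (x + 1)
  have hpq : p ≤ q := by nlinarith
  have : 2 * (p⁻¹ - q⁻¹) - q⁻¹ ^ 3 = (2 * q^2 * (q - p) - p) / (p * q^3) := by
    field_simp
  have h3 : (q - p) * (q + p) = 1 := by nlinarith
  have h4 : 0 ≤ 2 * q^2 * (q - p) - p := by
    have : q ^ 2 ≥ q * (q+p) / 2 := by nlinarith
    have h5 : 0 ≤ q - p := by linarith
    nlinarith [mul_le_mul_of_nonneg_right this h5]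
  have : 0 ≤ 2 * (p⁻¹ - q⁻¹) - q⁻¹ ^ 3 := by rw [this]; positivity
  linarith

lemma sum_rpow_le (y : ℝ) (N M : ℕ) (hNM : N ≤ M) (hy : 0 < N + y) :
    ∑ n ∈ Finset.Ico N M, ((n : ℝ) + y + 1) ^ (-(3/2) : ℝ) ≤
      2 * ((Real.sqrt (N + y))⁻¹ - (Real.sqrt (M + y))⁻¹) := by
  induction M, hNM using Nat.le_induction with
  | base => simp
  | succ m hm ih =>
    rw [Finset.sum_Ico_succ_top hm]
    have hm' : (N : ℝ) ≤ m := by exact_mod_cast hm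
    have := rpow_step (x := m + y) (by linarith)
    push_cast
    rw [show (m : ℝ) + 1 + y = m + y + 1 by ring]
    linarith

lemma exp_diff (A B : ℂ) (hA : A.re ≤ 0) (hB : B.re ≤ 0) : ‖cexp A - cexp B‖ ≤ ‖A - B‖ := by
  have := Convex.norm_image_sub_le_of_norm_hasDerivWithin_le (𝕜 := ℂ) (f := cexp) (f' := cexp) (C := 1)
    (s := {z : ℂ | z.re ≤ 0}) (x := B) (y := A)
    (fun z _ => (Complex.hasDerivAt_exp z).hasDerivWithinAt)
    (fun z hz => by rw [Complex.norm_exp]; exact Real.exp_le_one_iff.mpr hz)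
    (convex_halfSpace_re_le 0) hB hA
  simpa using this

noncomputable def LL (x : ℝ) : ℝ := Real.log (x + 1) - Real.log x

lemma LL_nonneg {x : ℝ} (hx : 0 < x) : 0 ≤ LL x :=
  sub_nonneg.mpr (Real.log_le_log hx (by linarith))

lemma LL_le {x : ℝ} (hx : 0 < x) : LL x ≤ 1 / x := by
  rw [LL, ← Real.log_div (by linarith) hx.ne']
  refine (Real.log_le_sub_one_of_pos (by positivity)).trans (le_of_eq ?_)
  field_simp; ring

lemma LL_ge {x : ℝ} (hx : 0 < x) : 1 / (x + 1) ≤ LL x := by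
  rw [LL, ← neg_sub, ← Real.log_div hx.ne' (by linarith)]
  have := Real.log_le_sub_one_of_pos (show 0 < x / (x + 1) by positivity)
  have h : x / (x + 1) - 1 = - (1 / (x+1)) := by field_simp; ring
  linarith

lemma LL_diff {x : ℝ} (hx : 0 < x) : |LL (x + 1) - LL x| ≤ 1 / (x * (x + 2)) := by
  have h1 : LL x - LL (x + 1) = Real.log ((x+1)^2 / (x * (x+2))) := by
    rw [Real.log_div (by positivity) (by positivity), Real.log_pow, Real.log_mul (by positivity) (by positivity),
      LL, LL, show x + 1 + 1 = x + 2 by ring]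
    push_cast; ring
  have h2 := Real.log_le_sub_one_of_pos (show 0 < (x+1)^2 / (x * (x+2)) by positivity)
  have h3 : (x+1)^2 / (x * (x+2)) - 1 = 1 / (x * (x+2)) := by field_simp; ring
  have h4 : 0 ≤ Real.log ((x+1)^2 / (x * (x+2))) := by
    apply Real.log_nonneg
    have : 0 ≤ 1 / (x * (x+2)) := by positivity
    linarith
  rw [abs_sub_comm, h1, abs_of_nonneg h4]
  linarith

lemma PP_succ (x : ℝ) (s : ℂ) : PP (x + 1) s = PP x s * cexp (-s * (LL x : ℂ)) := by
  rw [PP, PP, ← Complex.exp_add, LL]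
  congr 1; push_cast; ring

lemma KL (ω : ℂ) (hω : ‖ω‖ = 1) (K v y : ℝ) (hK : 0 < K) (hv : 1 ≤ v) (N M : ℕ) (hNM : N ≤ M)
    (hy : 0 < N + y)
    (hq : ∀ X : ℝ, N + y ≤ X → v / (K * X) ≤ ‖1 - ω * cexp (-(3/2 + I * v) * (LL X : ℂ))‖) :
    ‖∑ n ∈ Finset.Ico N M, ω ^ n * PP (n + y) (3/2 + I * v)‖ ≤
      (2 * K + 5 * K ^ 2) / (v * Real.sqrt (N + y)) := by
  have hv0 : 0 < v := by linarith
  set p : ℂ := 3/2 + I * v with hp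
  have hpre : p.re = 3/2 := by simp [hp]
  have hpn : ‖p‖ ≤ 5/2 * v := by
    calc ‖p‖ ≤ ‖(3/2 : ℂ)‖ + ‖I * (v:ℂ)‖ := norm_add_le _ _
      _ = 3/2 + v := by simp [abs_of_pos hv0]
      _ ≤ _ := by linarith
  let h : ℕ → ℂ := fun n => ω ^ n * PP (n + y) p
  let q : ℕ → ℂ := fun n => ω * cexp (-p * (LL (n + y) : ℂ))
  let c : ℕ → ℂ := fun n => (1 - q n)⁻¹
  have hX : ∀ n, N ≤ n → (N : ℝ) + y ≤ n + y := fun n hn => by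
    have : (N : ℝ) ≤ n := by exact_mod_cast hn
    linarith
  have hqn : ∀ n, N ≤ n → v / (K * (n + y)) ≤ ‖1 - q n‖ := fun n hn => hq _ (hX n hn)
  have hqpos : ∀ n, N ≤ n → 0 < ‖1 - q n‖ := fun n hn => by
    have : (0:ℝ) < n + y := by linarith [hX n hn]
    exact lt_of_lt_of_le (by positivity) (hqn n hn)
  have hcn : ∀ n, N ≤ n → ‖c n‖ ≤ K * (n + y) / v := fun n hn => by
    have : (0:ℝ) < n + y := by linarith [hX n hn]
    rw [norm_inv]
    have := inv_anti₀ (by positivity) (hqn n hn)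
    rwa [inv_div] at this
  have hh : ∀ n, N ≤ n → ‖h n‖ = (n + y) ^ (-(3/2) : ℝ) := fun n hn => by
    have : (0:ℝ) < n + y := by linarith [hX n hn]
    rw [norm_mul, norm_pow, hω, one_pow, one_mul, PP_norm this, hpre]
  have hr : ∀ x : ℝ, 0 < x → x ^ (-(3/2) : ℝ) * x = (Real.sqrt x)⁻¹ := fun x hx => by
    nth_rewrite 2 [← Real.rpow_one x]
    rw [← Real.rpow_add hx, Real.sqrt_eq_rpow, ← Real.rpow_neg hx.le]
    norm_num
  have hhc : ∀ n, N ≤ n → ‖h n * c n‖ ≤ K / v * (Real.sqrt (N + y))⁻¹ := fun n hn => by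
    have hp0 : (0:ℝ) < n + y := by linarith [hX n hn]
    rw [norm_mul, hh n hn]
    calc _ ≤ (n + y) ^ (-(3/2) : ℝ) * (K * (n + y) / v) := by
          gcongr; exact hcn n hn
      _ = K / v * (Real.sqrt (n + y))⁻¹ := by rw [← hr _ hp0]; ring
      _ ≤ _ := by
        gcongr
  have hcd : ∀ n, N ≤ n → ‖c (n + 1) - c n‖ ≤ 5/2 * K^2 / v := fun n hn => by
    have hp0 : (0:ℝ) < n + y := by linarith [hX n hn]
    have e1 : 1 - q n ≠ 0 := norm_pos_iff.mp (hqpos n hn)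
    have e2 : 1 - q (n + 1) ≠ 0 := norm_pos_iff.mp (hqpos (n+1) (by omega))
    have e3 : c (n + 1) - c n = c (n+1) * c n * (q (n+1) - q n) := by
      simp only [c]; field_simp; ring
    have e4 : ‖q (n+1) - q n‖ ≤ ‖p‖ * (1 / ((n + y) * (n + y + 2))) := by
      simp only [q]
      rw [← mul_sub, norm_mul, hω, one_mul]
      refine (exp_diff _ _ ?_ ?_).trans ?_
      · have := LL_nonneg (x := ((n + 1 : ℕ) : ℝ) + y) (by push_cast; linarith)
        rw [Complex.re_mul_ofReal, Complex.neg_re, hpre]; nlinarith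
      · have := LL_nonneg hp0
        rw [Complex.re_mul_ofReal, Complex.neg_re, hpre]; nlinarith
      · rw [← mul_sub, norm_mul, norm_neg, ← Complex.ofReal_sub, Complex.norm_real, Real.norm_eq_abs]
        gcongr
        have := LL_diff hp0
        rwa [show (n:ℝ) + y + 1 = ((n + 1 : ℕ) : ℝ) + y by push_cast; ring] at this
    have e5 := hcn n hn
    have e6 := hcn (n+1) (by omega)
    push_cast at e6
    rw [e3, norm_mul, norm_mul]
    calc _ ≤ (K * (n + 1 + y) / v) * (K * (n + y) / v) * ((5/2 * v) * (1 / ((n + y) * (n + y + 2)))) := by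
          have : ‖q (n+1) - q n‖ ≤ (5/2 * v) * (1 / ((n + y) * (n + y + 2))) := e4.trans (by gcongr)
          have h0 : (0:ℝ) ≤ n + 1 + y := by linarith
          gcongr
      _ = 5/2 * K^2 / v * ((n + y + 1) / (n + y + 2)) := by field_simp; ring
      _ ≤ 5/2 * K^2 / v * 1 := by
          gcongr
          rw [div_le_one (by linarith)]; linarith
      _ = _ := by ring
  have key := abel_id h q c (fun n => by
    simp only [h, q]
    rw [show ((n + 1 : ℕ) : ℝ) + y = n + y + 1 by push_cast; ring, PP_succ]; ring) N M hNM
    (fun n hn => inv_mul_cancel₀ (norm_pos_iff.mp (hqpos n hn)))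
  change ‖∑ n ∈ Finset.Ico N M, h n‖ ≤ _
  rw [key]
  have hs : ‖∑ n ∈ Finset.Ico N M, h (n + 1) * (c (n + 1) - c n)‖ ≤
      5/2 * K^2 / v * (2 * ((Real.sqrt (N + y))⁻¹ - (Real.sqrt (M + y))⁻¹)) := by
    refine le_trans ?_ (mul_le_mul_of_nonneg_left (sum_rpow_le y N M hNM hy) (by positivity))
    rw [Finset.mul_sum]
    refine norm_sum_le_of_le _ (fun n hn => ?_)
    have hn' := (Finset.mem_Ico.mp hn).1
    rw [norm_mul, hh _ (by omega), mul_comm, show ((n + 1 : ℕ) : ℝ) + y = n + y + 1 by push_cast; ring]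
    have hp0 : (0:ℝ) < n + y + 1 := by linarith [hX n hn']
    gcongr
    exact hcd n hn'
  have hM : 0 ≤ (Real.sqrt (M + y))⁻¹ := by positivity
  have e0 : (2 * K + 5 * K ^ 2) / (v * Real.sqrt (N + y)) =
      K / v * (Real.sqrt (N + y))⁻¹ + K / v * (Real.sqrt (N + y))⁻¹ +
        5/2 * K^2 / v * (2 * (Real.sqrt (N + y))⁻¹) := by
    have : 0 < Real.sqrt (N + y) := Real.sqrt_pos.mpr hy
    field_simp; ring
  rw [e0]
  refine (norm_add_le _ _).trans (add_le_add ((norm_sub_le _ _).trans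
    (add_le_add (hhc N le_rfl) (hhc M hNM))) (hs.trans ?_))
  gcongr
  linarith

/-- tail of integrated sums -/
lemma KL_int (ω : ℂ) (hω : ‖ω‖ = 1) (K v β : ℝ) (hK : 0 < K) (hv : 1 ≤ v) (N M : ℕ) (hNM : N ≤ M)
    (hβ : 0 < β) (ψ : ℝ → ℝ) (hψc : Continuous ψ) (hψ : ∀ u ∈ Set.Icc (0:ℝ) 1, |ψ u| ≤ 1)
    (hq : ∀ X : ℝ, N + β ≤ X → v / (K * X) ≤ ‖1 - ω * cexp (-(3/2 + I * v) * (LL X : ℂ))‖) :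
    ‖∑ n ∈ Finset.Ico N M, ω ^ n * ∫ u in (0:ℝ)..1, (ψ u : ℂ) * PP (n + β + u) (1/2 + I * v + 1)‖ ≤
      (2 * K + 5 * K ^ 2) / (v * Real.sqrt (N + β)) := by
  have hs : (1/2 + I * v + 1 : ℂ) = 3/2 + I * v := by ring
  rw [hs]
  have hN0 : (0:ℝ) ≤ N := N.cast_nonneg
  have e : ∑ n ∈ Finset.Ico N M, ω ^ n * ∫ u in (0:ℝ)..1, (ψ u : ℂ) * PP (n + β + u) (3/2 + I * v) =
      ∫ u in (0:ℝ)..1, ∑ n ∈ Finset.Ico N M, ω ^ n * ((ψ u : ℂ) * PP (n + β + u) (3/2 + I * v)) := by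
    rw [intervalIntegral.integral_finsetSum]
    · simp_rw [intervalIntegral.integral_const_mul]
    · intro n _
      apply ContinuousOn.intervalIntegrable
      rw [Set.uIcc_of_le zero_le_one]
      exact continuousOn_const.mul ((Complex.continuous_ofReal.comp hψc).continuousOn.mul
        (PP_cont (by positivity) _))
  rw [e]
  have := intervalIntegral.norm_integral_le_of_norm_le_const (a := 0) (b := 1)
    (f := fun u : ℝ => ∑ n ∈ Finset.Ico N M, ω ^ n * ((ψ u : ℂ) * PP (n + β + u) (3/2 + I * v)))
    (C := (2 * K + 5 * K ^ 2) / (v * Real.sqrt (N + β))) (by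
      intro u hu
      rw [Set.uIoc_of_le zero_le_one] at hu
      have h1 := KL ω hω K v (β + u) hK hv N M hNM (by linarith [hu.1])
        (fun X hX => hq X (by linarith [hu.1]))
      have h2 : ∑ n ∈ Finset.Ico N M, ω ^ n * ((ψ u : ℂ) * PP (n + β + u) (3/2 + I * v)) =
          (ψ u : ℂ) * ∑ n ∈ Finset.Ico N M, ω ^ n * PP (n + (β + u)) (3/2 + I * v) := by
        rw [Finset.mul_sum]
        refine Finset.sum_congr rfl (fun n _ => ?_)
        rw [add_assoc]; ring
      rw [h2, norm_mul, Complex.norm_real, Real.norm_eq_abs]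
      calc _ ≤ 1 * ((2 * K + 5 * K ^ 2) / (v * Real.sqrt (N + (β + u)))) :=
            mul_le_mul (hψ u ⟨hu.1.le, hu.2⟩) h1 (norm_nonneg _) zero_le_one
        _ ≤ _ := by
          rw [one_mul]
          have : 0 < Real.sqrt (N + β) := Real.sqrt_pos.mpr (by linarith)
          gcongr
          linarith [hu.1])
  simpa using this

lemma tail_le (g : ℕ → ℂ) (S : ℂ) (h : HasSum g S) (N : ℕ) (B : ℝ)
    (hB : ∀ M, N ≤ M → ‖∑ n ∈ Finset.Ico N M, g n‖ ≤ B) :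
    ‖S - ∑ n ∈ Finset.range N, g n‖ ≤ B := by
  refine le_of_tendsto ((h.tendsto_sum_nat.sub_const _).norm) ?_
  filter_upwards [Filter.eventually_ge_atTop N] with M hM
  rw [← Finset.sum_Ico_eq_sub _ hM]
  exact hB M hM


lemma one_sub_lower (ρ φ : ℝ) (hρ : 1/4 ≤ ρ) : |Real.sin (φ / 2)| ≤ ‖1 - (ρ : ℂ) * cexp (φ * I)‖ := by
  refine abs_le_of_sq_le_sq ?_ (norm_nonneg _)
  have hre : (1 - (ρ : ℂ) * cexp (φ * I)).re = 1 - ρ * Real.cos φ := by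
    rw [Complex.sub_re, Complex.re_ofReal_mul, Complex.exp_ofReal_mul_I_re, Complex.one_re]
  have him : (1 - (ρ : ℂ) * cexp (φ * I)).im = - (ρ * Real.sin φ) := by
    rw [Complex.sub_im, Complex.im_ofReal_mul, Complex.exp_ofReal_mul_I_im, Complex.one_im]; ring
  rw [Complex.sq_norm, Complex.normSq_apply, hre, him]
  have h1 : Real.cos φ = 1 - 2 * Real.sin (φ / 2) ^ 2 := by
    have := Real.cos_two_mul (φ / 2)
    rw [show 2 * (φ / 2) = φ by ring] at this
    nlinarith [Real.sin_sq_add_cos_sq (φ / 2)]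
  have h2 := Real.sin_sq_add_cos_sq φ
  have h3 : (1 - ρ * Real.cos φ) * (1 - ρ * Real.cos φ) + -(ρ * Real.sin φ) * -(ρ * Real.sin φ) =
      (1 - ρ) ^ 2 + 4 * ρ * Real.sin (φ / 2) ^ 2 := by
    have : (1 - ρ * Real.cos φ) * (1 - ρ * Real.cos φ) + -(ρ * Real.sin φ) * -(ρ * Real.sin φ) =
      1 - 2 * ρ * Real.cos φ + ρ ^ 2 * (Real.sin φ ^ 2 + Real.cos φ ^ 2) := by ring
    rw [this, h2, h1]; ring
  rw [h3]
  nlinarith [sq_nonneg (1 - ρ), sq_nonneg (Real.sin (φ / 2))]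

lemma exp_polar (v X b : ℝ) : cexp (2 * Real.pi * I * b) * cexp (-(3/2 + I * v) * (LL X : ℂ)) =
    ((Real.exp (-(3/2) * LL X) : ℝ) : ℂ) * cexp (((2 * Real.pi * b - v * LL X : ℝ) : ℂ) * I) := by
  rw [Complex.ofReal_exp, ← Complex.exp_add, ← Complex.exp_add]
  congr 1; push_cast; ring

lemma rho_ge {X : ℝ} (hX : 2 ≤ X) : 1/4 ≤ Real.exp (-(3/2) * LL X) := by
  have h1 := Real.add_one_le_exp (-(3/2) * LL X)
  have h2 := LL_le (show 0 < X by linarith)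
  have h3 : 1 / X ≤ 1 / 2 := by gcongr
  linarith

lemma cond_H (v X : ℝ) (hv : 1 ≤ v) (hX : 2 ≤ X) (hvX : v ≤ X) :
    v / (7 * X) ≤ ‖1 - 1 * cexp (-(3/2 + I * v) * (LL X : ℂ))‖ := by
  have h := exp_polar v X 0
  simp only [ofReal_zero, mul_zero, Complex.exp_zero] at h
  rw [h]
  refine le_trans ?_ (one_sub_lower _ _ (rho_ge hX))
  have h1 := LL_le (show 0 < X by linarith)
  have h2 := LL_ge (show 0 < X by linarith)
  have h3 := LL_nonneg (show 0 < X by linarith)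
  have hpi := Real.pi_gt_three
  have hpi' := Real.pi_lt_d2
  rw [show (0 - v * LL X) / 2 = -(v * LL X / 2) by ring, Real.sin_neg, abs_neg]
  have h4 : v * LL X ≤ 1 := by
    calc v * LL X ≤ X * (1 / X) := by gcongr
      _ = 1 := by field_simp
  have h5 := Real.mul_le_sin (x := v * LL X / 2) (by positivity) (by linarith)
  refine le_trans ?_ (h5.trans (le_abs_self _))
  calc v / (7 * X) ≤ v / (Real.pi * (X + 1)) := by
        exact div_le_div_of_nonneg_left (by linarith) (by positivity) (by nlinarith)
    _ = 2 / Real.pi * (v * (1 / (X + 1)) / 2) := by field_simp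
    _ ≤ _ := by gcongr

lemma sin_ge_of_mem (a y : ℝ) (ha : 0 < a) (h1 : a ≤ y) (h2 : y ≤ Real.pi - a) :
    Real.sin a ≤ Real.sin y := by
  rcases le_total y (Real.pi / 2) with h | h
  · exact Real.sin_le_sin_of_le_of_le_pi_div_two (by linarith) h h1
  · rw [← Real.sin_pi_sub y]
    exact Real.sin_le_sin_of_le_of_le_pi_div_two (by linarith) (by linarith) (by linarith)

lemma cond_L (a b v X : ℝ) (ha : 0 < a) (ha' : a ≤ 1/2) (hb : a ≤ b) (hb' : b ≤ 1 - a)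
    (hv : 1 ≤ v) (hX : 2 ≤ X) (hvX : v ≤ 2 * a * X) :
    v / ((1 / Real.sin a) * X) ≤
      ‖1 - cexp (2 * Real.pi * I * b) * cexp (-(3/2 + I * v) * (LL X : ℂ))‖ := by
  rw [exp_polar]
  refine le_trans ?_ (one_sub_lower _ _ (rho_ge hX))
  have h1 := LL_le (show 0 < X by linarith)
  have h3 := LL_nonneg (show 0 < X by linarith)
  have hpi := Real.pi_gt_three
  have hs : 0 < Real.sin a := Real.sin_pos_of_pos_of_lt_pi ha (by linarith)
  have h4 : v * LL X ≤ 2 * a := by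
    calc v * LL X ≤ (2 * a * X) * (1 / X) := by gcongr
      _ = 2 * a := by field_simp
  have h5 : 0 ≤ v * LL X := by positivity
  have h6 := sin_ge_of_mem a ((2 * Real.pi * b - v * LL X) / 2) ha (by nlinarith) (by nlinarith)
  refine le_trans ?_ (h6.trans (le_abs_self _))
  rw [div_le_iff₀ (by positivity)]
  calc v ≤ X := by nlinarith
    _ = _ := by field_simp

lemma FF_diff (x : ℝ) (s : ℂ) (hs : s ≠ 1) : DifferentiableAt ℂ (fun s => FF x s) s := by
  unfold FF PP
  have : s - 1 ≠ 0 := sub_ne_zero.mpr hs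
  fun_prop (disch := assumption)

lemma FF_norm {x : ℝ} (hx : 0 < x) (s : ℂ) : ‖FF x s‖ = x ^ (1 - s.re) / ‖s - 1‖ := by
  rw [FF, norm_div, PP_norm hx]
  simp

lemma ne_one_of_im {s : ℂ} (hs : 0 < s.im) : s ≠ 1 := by
  rintro rfl; simp at hs

lemma hurw_hasSum (α : ℝ) (h0 : 0 < α) (h1 : α < 1) (s : ℂ) (hs : 1/4 < s.re) (hs' : 0 < s.im) :
    HasSum (fun n : ℕ => PP (n + (1 + α)) s - FF (n + (1 + α)) s + FF (n + (1 + α) + 1) s)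
      (hzeta α s - PP α s - FF (1 + α) s) := by
  refine cont_lemma (fun s => hzeta α s - PP α s - FF (1 + α) s) ?_
    (fun n s => PP (n + (1 + α)) s - FF (n + (1 + α)) s + FF (n + (1 + α) + 1) s) ?_
    (1 + α) (by linarith) 1 zero_le_one ?_ ?_ s hs hs'
  · intro s hs
    exact ((HurwitzZeta.differentiableAt_hurwitzZeta _ (ne_one_of_im hs)).sub (PP_diff α s)).sub
      (FF_diff _ _ (ne_one_of_im hs))
  · intro n s hs
    exact ((PP_diff _ s).sub (FF_diff _ _ (ne_one_of_im hs))).add (FF_diff _ _ (ne_one_of_im hs))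
  · intro n s hs hs'
    have hx : (0:ℝ) < n + (1 + α) := by positivity
    rw [PP_int2 hx s (ne_one_of_im hs'), norm_mul, one_mul]
    gcongr
    refine PP_int_bound hx s (by linarith) _ (fun u hu => ?_)
    rw [abs_le]; constructor <;> linarith [hu.1, hu.2]
  · intro s hs hs' hsum
    rw [hsum.hasSum_iff_tendsto_nat]
    have hz := HurwitzZeta.hasSum_hurwitzZeta_of_one_lt_re (a := α) ⟨h0.le, h1.le⟩ hs
    have hz' : HasSum (fun n : ℕ => PP (n + α) s) (hzeta α s) := by
      refine hz.congr_fun (fun n => ?_)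
      rw [← PP_inv (by positivity)]; push_cast; rfl
    have hz2 := ((hasSum_nat_add_iff' 1).mpr hz').tendsto_sum_nat
    have hF : Filter.Tendsto (fun M : ℕ => FF (M + (1 + α)) s) Filter.atTop (nhds 0) := by
      rw [tendsto_zero_iff_norm_tendsto_zero]
      have hx : ∀ n : ℕ, (0:ℝ) < n + (1 + α) := fun n => by positivity
      simp_rw [fun n : ℕ => FF_norm (hx n) s]
      rw [← zero_div ‖s - 1‖]
      refine Filter.Tendsto.div_const ?_ _
      rw [show 1 - s.re = -(s.re - 1) by ring]
      exact (tendsto_rpow_neg_atTop (by linarith)).comp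
        (Filter.tendsto_atTop_add_const_right _ _ tendsto_natCast_atTop_atTop)
    have hh := (hz2.add hF).sub_const (FF (1 + α) s)
    simp only [Finset.range_one, Finset.sum_singleton, Nat.cast_zero, zero_add, add_zero] at hh
    refine hh.congr (fun M => ?_)
    have : ∀ M : ℕ, ∑ n ∈ Finset.range M, (PP (n + (1 + α)) s - FF (n + (1 + α)) s + FF (n + (1 + α) + 1) s) =
        ∑ n ∈ Finset.range M, PP ((n + 1 : ℕ) + α) s + FF (M + (1 + α)) s - FF (1 + α) s := by
      intro M
      induction M with
      | zero => simp
      | succ m ih =>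
        rw [Finset.sum_range_succ, Finset.sum_range_succ, ih]
        push_cast
        rw [show (m:ℝ) + 1 + α = m + (1 + α) by ring, show (m:ℝ) + 1 + (1 + α) = m + (1 + α) + 1 by ring]
        ring
    rw [this]

lemma hurw_partial (α : ℝ) (s : ℂ) (M : ℕ) :
    ∑ n ∈ Finset.range M, (PP (n + (1 + α)) s - FF (n + (1 + α)) s + FF (n + (1 + α) + 1) s) =
        ∑ n ∈ Finset.range M, PP ((n + 1 : ℕ) + α) s + FF (M + (1 + α)) s - FF (1 + α) s := by
  induction M with
  | zero => simp
  | succ m ih =>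
    rw [Finset.sum_range_succ, Finset.sum_range_succ, ih]
    push_cast
    rw [show (m:ℝ) + 1 + α = m + (1 + α) by ring, show (m:ℝ) + 1 + (1 + α) = m + (1 + α) + 1 by ring]
    ring

lemma norm_s_le (v : ℝ) (hv : 1 ≤ v) : ‖(1/2 + I * v : ℂ)‖ ≤ 2 * v := by
  calc ‖(1/2 + I * v : ℂ)‖ ≤ ‖(1/2 : ℂ)‖ + ‖I * (v:ℂ)‖ := norm_add_le _ _
      _ = 1/2 + v := by simp [abs_of_pos (show 0 < v by linarith)]
      _ ≤ _ := by linarith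

lemma hurw_approx (α : ℝ) (h0 : 0 < α) (h1 : α < 1) (v : ℝ) (hv : 1 ≤ v) (N : ℕ) (hN : 2 ≤ N)
    (hvN : v ≤ N) :
    ‖hzeta α (1/2 + I * v) - ∑ n ∈ Finset.range N, PP (n + α) (1/2 + I * v)‖ ≤
      518 / Real.sqrt N + Real.sqrt (N + 1) / v := by
  obtain ⟨N', rfl⟩ : ∃ N', N = N' + 1 := ⟨N - 1, by omega⟩
  push_cast at *
  have hN' : (1:ℝ) ≤ N' := by exact_mod_cast (by omega : 1 ≤ N')
  have hre : (1/2 + I * v : ℂ).re = 1/2 := by simp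
  have him : (1/2 + I * v : ℂ).im = v := by simp
  have hs1 : (1/2 + I * v : ℂ) ≠ 1 := ne_one_of_im (by rw [him]; linarith)
  have H := hurw_hasSum α h0 h1 (1/2 + I * v) (by rw [hre]; norm_num) (by rw [him]; linarith)
  have hv0 : 0 < v := by linarith
  have T := tail_le _ _ H N' (518 / Real.sqrt (N' + 1)) (by
    intro M hM
    have e : ∀ n ∈ Finset.Ico N' M, (PP (n + (1 + α)) (1/2 + I * v) - FF (n + (1 + α)) (1/2 + I * v)
        + FF (n + (1 + α) + 1) (1/2 + I * v)) = (1/2 + I * v) *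
        (1 ^ n * ∫ u in (0:ℝ)..1, ((fun u => 1 - u : ℝ → ℝ) u : ℂ) * PP (n + (1 + α) + u) (1/2 + I * v + 1)) := by
      intro n _
      rw [PP_int2 (by positivity) _ hs1, one_pow, one_mul]
    rw [Finset.sum_congr rfl e, ← Finset.mul_sum, norm_mul]
    have k := KL_int 1 (by simp) 7 v (1 + α) (by norm_num) hv N' M hM (by linarith) (fun u => 1 - u)
      (by fun_prop) (fun u hu => by rw [abs_le]; constructor <;> linarith [hu.1, hu.2])
      (fun X hX => cond_H v X hv (by linarith) (by linarith))
    have hsq : 0 < Real.sqrt (N' + 1) := Real.sqrt_pos.mpr (by linarith)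
    calc _ ≤ (2 * v) * ((2 * 7 + 5 * 7 ^ 2) / (v * Real.sqrt (N' + (1 + α)))) :=
          mul_le_mul (norm_s_le v hv) k (norm_nonneg _) (by linarith)
      _ ≤ (2 * v) * ((2 * 7 + 5 * 7 ^ 2) / (v * Real.sqrt (N' + 1))) := by
          gcongr; linarith
      _ = _ := by field_simp; norm_num)
  rw [hurw_partial] at T
  rw [Finset.sum_range_succ']
  have hF : ‖FF (N' + (1 + α)) (1/2 + I * v)‖ ≤ Real.sqrt (N' + 1 + 1) / v := by
    rw [FF_norm (by positivity), hre, show (1:ℝ) - 1/2 = 1/2 by norm_num, ← Real.sqrt_eq_rpow]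
    have : v ≤ ‖(1/2 + I * v - 1 : ℂ)‖ := by
      have := Complex.abs_im_le_norm (1/2 + I * v - 1 : ℂ)
      rw [Complex.sub_im, him, Complex.one_im, sub_zero, abs_of_pos hv0] at this
      exact this
    gcongr ?_ / ?_
    exact Real.sqrt_le_sqrt (by linarith)
  refine le_trans (le_of_eq ?_) ((norm_add_le _ _).trans (add_le_add T hF))
  congr 1
  simp only [Nat.cast_zero, zero_add]
  ring

lemma per_partial (ω : ℂ) (hω : 1 - ω ≠ 0) (s : ℂ) (M : ℕ) :
    ∑ n ∈ Finset.range M, ((1 - ω)⁻¹ * ω * ω ^ n * (PP (n + 1 + 1) s - PP (n + 1) s)) =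
      ∑ n ∈ Finset.range M, ω ^ n * PP (n + 1) s + (1 - ω)⁻¹ * ω ^ M * PP (M + 1) s
        - (1 - ω)⁻¹ * PP 1 s := by
  induction M with
  | zero => simp
  | succ m ih =>
    rw [Finset.sum_range_succ, Finset.sum_range_succ, ih]
    push_cast
    field_simp
    ring

lemma per_hasSum (b : ℝ) (ω : ℂ) (hωd : ω = cexp (2 * Real.pi * I * b)) (hω : 1 - ω ≠ 0) (hω1 : ‖ω‖ = 1)
    (s : ℂ) (hs : 1/4 < s.re) (hs' : 0 < s.im) :
    HasSum (fun n : ℕ => (1 - ω)⁻¹ * ω * ω ^ n * (PP (n + 1 + 1) s - PP (n + 1) s))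
      (ω⁻¹ * pzeta b s - (1 - ω)⁻¹ * PP 1 s) := by
  have hω0 : ω ≠ 0 := by rintro rfl; simp at hω1
  refine cont_lemma (fun s => ω⁻¹ * pzeta b s - (1 - ω)⁻¹ * PP 1 s) ?_
    (fun n s => (1 - ω)⁻¹ * ω * ω ^ n * (PP (n + 1 + 1) s - PP (n + 1) s)) ?_
    1 le_rfl ‖(1 - ω)⁻¹‖ (norm_nonneg _) ?_ ?_ s hs hs'
  · intro s hs
    exact ((HurwitzZeta.differentiableAt_expZeta _ s (Or.inl (ne_one_of_im hs))).const_mul _).sub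
      ((PP_diff 1 s).const_mul _)
  · intro n s hs
    exact ((PP_diff _ s).sub (PP_diff _ s)).const_mul _
  · intro n s hs hs'
    have hx : (0:ℝ) < n + 1 := by positivity
    rw [PP_int1 hx s]
    simp only [norm_mul, norm_pow, hω1, one_pow, mul_one, norm_neg]
    rw [mul_assoc]
    gcongr
    have := PP_int_bound hx s (by linarith) (fun _ => 1) (fun u hu => by simp)
    simpa using this
  · intro s hs hs' hsum
    rw [hsum.hasSum_iff_tendsto_nat]
    have hz : HasSum (fun n : ℕ ↦ cexp (2 * Real.pi * I * b * n) / (n : ℂ) ^ s) (pzeta b s) :=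
      HurwitzZeta.hasSum_expZeta_of_one_lt_re b hs
    have hs0 : s ≠ 0 := by rintro rfl; simp at hs'
    have hz1 := ((hasSum_nat_add_iff' 1).mpr hz).mul_left ω⁻¹
    simp only [Finset.range_one, Finset.sum_singleton, Nat.cast_zero, Complex.zero_cpow hs0, div_zero, sub_zero] at hz1
    have hz2 : HasSum (fun n : ℕ => ω ^ n * PP (n + 1) s) (ω⁻¹ * pzeta b s) := by
      refine hz1.congr_fun (fun n => ?_)
      have e : ω ^ n = ω⁻¹ * cexp (2 * Real.pi * I * b * (n + 1 : ℕ)) := by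
        rw [hωd, ← Complex.exp_nat_mul, ← Complex.exp_neg, ← Complex.exp_add]
        congr 1; push_cast; ring
      rw [← PP_inv (by positivity), e]
      push_cast
      ring
    have hF : Filter.Tendsto (fun M : ℕ => (1 - ω)⁻¹ * ω ^ M * PP (M + 1) s) Filter.atTop (nhds 0) := by
      rw [tendsto_zero_iff_norm_tendsto_zero]
      have hx : ∀ n : ℕ, (0:ℝ) < n + 1 := fun n => by positivity
      simp_rw [norm_mul, norm_pow, hω1, one_pow, mul_one, fun n : ℕ => PP_norm (hx n) s]
      rw [← mul_zero ‖(1 - ω)⁻¹‖]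
      refine Filter.Tendsto.const_mul _ ?_
      exact (tendsto_rpow_neg_atTop (by linarith)).comp
        (Filter.tendsto_atTop_add_const_right _ _ tendsto_natCast_atTop_atTop)
    have hh := (hz2.tendsto_sum_nat.add hF).sub_const ((1 - ω)⁻¹ * PP 1 s)
    simp only [add_zero] at hh
    refine hh.congr (fun M => ?_)
    rw [per_partial ω hω]

lemma per_approx (a : ℝ) (ha : 0 < a) (ha' : a ≤ 1/2) (b : ℝ) (hb : a ≤ b) (hb' : b ≤ 1 - a) :
    ∃ C > 0, ∀ (v : ℝ) (_ : 1 ≤ v) (N : ℕ) (_ : 2 ≤ N) (_ : v ≤ 2 * a * N),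
    ‖pzeta b (1/2 + I * v) - ∑ n ∈ Finset.Ico 1 N, cexp (2 * Real.pi * I * b * n) * PP n (1/2 + I * v)‖ ≤
      C / Real.sqrt N := by
  set ω : ℂ := cexp (2 * Real.pi * I * b) with hωd
  have hω1 : ‖ω‖ = 1 := by
    rw [hωd, show (2 * Real.pi * I * b : ℂ) = ((2 * Real.pi * b : ℝ) : ℂ) * I by push_cast; ring]
    exact Complex.norm_exp_ofReal_mul_I _
  have hω0 : ω ≠ 0 := Complex.exp_ne_zero _
  have hpi := Real.pi_gt_three
  have hsin : 0 < Real.sin a := Real.sin_pos_of_pos_of_lt_pi ha (by linarith)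
  have hω : 1 - ω ≠ 0 := by
    rw [← norm_pos_iff]
    have h := one_sub_lower 1 (2 * Real.pi * b) (by norm_num)
    have h6 := sin_ge_of_mem a (2 * Real.pi * b / 2) ha (by nlinarith) (by nlinarith)
    have h7 : (1 - ((1 : ℝ) : ℂ) * cexp ((2 * Real.pi * b : ℝ) * I)) = 1 - ω := by
      rw [hωd, ofReal_one, one_mul]; congr 2; push_cast; ring
    rw [h7] at h
    linarith [le_abs_self (Real.sin (2 * Real.pi * b / 2))]
  set K := 1 / Real.sin a with hK
  have hK0 : 0 < K := by positivity
  have hcpos : 0 < ‖(1 - ω)⁻¹‖ := norm_pos_iff.mpr (inv_ne_zero hω)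
  refine ⟨‖(1 - ω)⁻¹‖ * (2 * (2 * K + 5 * K ^ 2)) + ‖(1 - ω)⁻¹‖, by positivity, ?_⟩
  intro v hv N hN hvN
  obtain ⟨N', rfl⟩ : ∃ N', N = N' + 1 := ⟨N - 1, by omega⟩
  push_cast at *
  have hN' : (1:ℝ) ≤ N' := by exact_mod_cast (by omega : 1 ≤ N')
  have hre : (1/2 + I * v : ℂ).re = 1/2 := by simp
  have him : (1/2 + I * v : ℂ).im = v := by simp
  have hv0 : 0 < v := by linarith
  have H := per_hasSum b ω hωd hω hω1 (1/2 + I * v) (by rw [hre]; norm_num) (by rw [him]; linarith)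
  have hsq : 0 < Real.sqrt (N' + 1) := Real.sqrt_pos.mpr (by linarith)
  have T := tail_le _ _ H N' (‖(1 - ω)⁻¹‖ * (2 * (2 * K + 5 * K ^ 2)) / Real.sqrt (N' + 1)) (by
    intro M hM
    have e : ∀ n ∈ Finset.Ico N' M, ((1 - ω)⁻¹ * ω * ω ^ n * (PP (n + 1 + 1) (1/2 + I * v) - PP (n + 1) (1/2 + I * v))) =
        ((1 - ω)⁻¹ * ω * (-(1/2 + I * v))) *
        (ω ^ n * ∫ u in (0:ℝ)..1, ((fun _ => 1 : ℝ → ℝ) u : ℂ) * PP (n + 1 + u) (1/2 + I * v + 1)) := by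
      intro n _
      rw [PP_int1 (by positivity) _]; ring
    rw [Finset.sum_congr rfl e, ← Finset.mul_sum, norm_mul, norm_mul, norm_mul, hω1, norm_neg, mul_one]
    have k := KL_int ω hω1 K v 1 hK0 hv N' M hM (by linarith) (fun u => 1)
      (by fun_prop) (fun u hu => by simp)
      (fun X hX => cond_L a b v X ha ha' hb hb' hv (by linarith) (hvN.trans (by gcongr)))
    calc _ ≤ (‖(1 - ω)⁻¹‖ * (2 * v)) * ((2 * K + 5 * K ^ 2) / (v * Real.sqrt (N' + 1))) :=
          mul_le_mul (by gcongr; exact norm_s_le v hv) k (norm_nonneg _) (by positivity)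
      _ = _ := by field_simp)
  rw [per_partial ω hω] at T
  have hF : ‖(1 - ω)⁻¹ * ω ^ N' * PP (N' + 1) (1/2 + I * v)‖ ≤ ‖(1 - ω)⁻¹‖ / Real.sqrt (N' + 1) := by
    rw [norm_mul, norm_mul, norm_pow, hω1, one_pow, mul_one, PP_norm (by positivity), hre,
      Real.rpow_neg (by positivity), ← Real.sqrt_eq_rpow]
    exact le_of_eq (by rw [div_eq_mul_inv])
  have e2 : ∑ n ∈ Finset.Ico 1 (N' + 1), cexp (2 * Real.pi * I * b * n) * PP n (1/2 + I * v) =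
      ω * ∑ n ∈ Finset.range N', ω ^ n * PP (n + 1) (1/2 + I * v) := by
    rw [Finset.sum_Ico_eq_sum_range, Finset.mul_sum]
    refine Finset.sum_congr (by simp) (fun n _ => ?_)
    rw [← mul_assoc, ← pow_succ', hωd, ← Complex.exp_nat_mul]
    push_cast
    rw [add_comm (1:ℝ), mul_comm (_ + 1 : ℂ), add_comm (1:ℂ)]
  rw [e2, add_div]
  refine le_trans (le_of_eq ?_) ((norm_add_le _ _).trans (add_le_add T hF))
  rw [← one_mul ‖pzeta b (1/2 + I * v) - _‖, ← inv_one, ← hω1, ← norm_inv, ← norm_mul]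
  congr 1
  field_simp
  ring

lemma PPv_cont (x : ℝ) : Continuous (fun v : ℝ => PP x (1/2 + I * v)) := by
  unfold PP; fun_prop

noncomputable def II (x k t : ℝ) : ℂ := ∫ v in (t - k)..(t + k), PP x (1/2 + I * v)

lemma II_eq (x k t : ℝ) (hl : Real.log x ≠ 0) :
    II x k t = 2 * (PP x (1/2 + I * t) * (Real.sin (k * Real.log x) : ℂ) / (Real.log x : ℂ)) := by
  have hl' : (Real.log x : ℂ) ≠ 0 := by exact_mod_cast hl
  set l : ℝ := Real.log x with hld
  have h := intervalIntegral.integral_eq_sub_of_hasDerivAt (a := t - k) (b := t + k)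
    (f := fun v : ℝ => cexp (-(1/2 + I * v) * l) / (-I * l)) (f' := fun v : ℝ => PP x (1/2 + I * v))
    (fun v _ => by
      have h0 : HasDerivAt (fun v : ℝ => (v : ℂ)) 1 v := Complex.ofRealCLM.hasDerivAt
      have h1 := (((h0.const_mul I).const_add (1/2)).neg.mul_const (l : ℂ)).cexp.div_const (-I * l)
      refine h1.congr_deriv ?_
      rw [PP, ← hld]
      have := I_ne_zero
      simp only [Pi.neg_apply]
      field_simp)
    ((PPv_cont x).intervalIntegrable _ _)
  rw [II, h, PP, ← hld, Complex.ofReal_sin, Complex.sin]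
  have e1 : cexp (-(1/2 + I * ((t + k : ℝ) : ℂ)) * l) = cexp (-(1/2 + I * t) * l) * cexp (-((k * l : ℝ) : ℂ) * I) := by
    rw [← Complex.exp_add]; congr 1; push_cast; ring
  have e2 : cexp (-(1/2 + I * ((t - k : ℝ) : ℂ)) * l) = cexp (-(1/2 + I * t) * l) * cexp (((k * l : ℝ) : ℂ) * I) := by
    rw [← Complex.exp_add]; congr 1; push_cast; ring
  rw [e1, e2]
  have := I_ne_zero
  field_simp
  rw [I_sq]
  ring

lemma II_one (k t : ℝ) : II 1 k t = 2 * k := by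
  unfold II PP
  simp
  ring

lemma II_bound (x k t : ℝ) (hx : 0 < x) (hl : Real.log x ≠ 0) :
    ‖II x k t‖ ≤ 2 * (x ^ (-(1/2) : ℝ) / |Real.log x|) := by
  rw [II_eq x k t hl, norm_mul, norm_div, norm_mul, PP_norm hx, Complex.norm_real, Complex.norm_real]
  have : (1/2 + I * t : ℂ).re = 1/2 := by simp
  rw [this, Real.norm_eq_abs, Real.norm_eq_abs]
  have h2 := Real.abs_sin_le_one (k * Real.log x)
  have h3 : 0 ≤ x ^ (-(1/2) : ℝ) := by positivity
  simp only [Complex.norm_ofNat]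
  gcongr
  nlinarith

lemma sin_term (x k t : ℝ) (hx : 0 < x) (hl : Real.log x ≠ 0) :
    (Real.sin (k * Real.log x) : ℂ) / ((x : ℂ) ^ ((1 : ℂ) / 2 + Complex.I * t) * (Real.log x : ℂ)) =
      II x k t / 2 := by
  rw [II_eq x k t hl, ← PP_inv hx]
  have hl' : (Real.log x : ℂ) ≠ 0 := by exact_mod_cast hl
  have : (x : ℂ) ^ ((1 : ℂ) / 2 + Complex.I * t) ≠ 0 := by
    rw [Ne, Complex.cpow_eq_zero_iff]
    have : (x : ℂ) ≠ 0 := by exact_mod_cast hx.ne'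
    tauto
  field_simp

lemma Ssum_eq (α m k t : ℝ) (hα : 0 < α) :
    Ssum α m k t = (∑ n ∈ Finset.Ico 2 ⌈t / m⌉₊, II (n + α) k t +
      ∑ n ∈ Finset.Ico 2 ⌈t / m⌉₊, cexp (2 * Real.pi * I * α * n) * II n k t) / 2 := by
  rw [Ssum, ← Finset.sum_add_distrib, Finset.sum_div]
  refine Finset.sum_congr rfl (fun n hn => ?_)
  have hn' : (2:ℝ) ≤ n := by exact_mod_cast (Finset.mem_Ico.mp hn).1
  rw [sin_term (n + α) k t (by linarith) (Real.log_pos (by linarith)).ne', mul_div_assoc]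
  have := sin_term n k t (by linarith) (Real.log_pos (by linarith)).ne'
  rw [Complex.ofReal_natCast] at this
  rw [this]
  ring

/-- The Dirichlet polynomial attached to one parameter. -/
noncomputable def DP (α : ℝ) (N : ℕ) (v : ℝ) : ℂ :=
  ∑ n ∈ Finset.range N, PP (n + α) (1/2 + I * v) +
    ∑ n ∈ Finset.Ico 1 N, cexp (2 * Real.pi * I * α * n) * PP n (1/2 + I * v)

lemma DP_cont (α : ℝ) (N : ℕ) : Continuous (DP α N) := by
  unfold DP
  exact (continuous_finsetSum _ (fun n _ => PPv_cont _)).add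
    (continuous_finsetSum _ (fun n _ => continuous_const.mul (PPv_cont _)))

lemma DP_int (α m k t : ℝ) (hα : 0 < α) (hN : 2 ≤ ⌈t / m⌉₊) :
    ∫ v in (t - k)..(t + k), DP α ⌈t / m⌉₊ v =
      2 * Ssum α m k t + II α k t + II (1 + α) k t + cexp (2 * Real.pi * I * α) * (2 * k) := by
  unfold DP
  rw [intervalIntegral.integral_add, intervalIntegral.integral_finsetSum, intervalIntegral.integral_finsetSum]
  · simp_rw [intervalIntegral.integral_const_mul]
    change ∑ n ∈ Finset.range ⌈t / m⌉₊, II (n + α) k t + ∑ n ∈ Finset.Ico (1:ℕ) ⌈t / m⌉₊,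
      cexp (2 * Real.pi * I * α * n) * II n k t = _
    rw [Ssum_eq α m k t hα, Finset.range_eq_Ico, Finset.sum_eq_sum_Ico_succ_bot (by omega),
      Finset.sum_eq_sum_Ico_succ_bot (show 0 + 1 < _ by omega),
      Finset.sum_eq_sum_Ico_succ_bot (show 1 < _ by omega) (fun n : ℕ => cexp (2 * Real.pi * I * α * n) * II n k t)]
    simp only [Nat.cast_zero, zero_add, Nat.cast_one, mul_one, Nat.reduceAdd, II_one]
    ring
  · exact fun n _ => (continuous_const.mul (PPv_cont _)).intervalIntegrable _ _
  · exact fun n _ => (PPv_cont _).intervalIntegrable _ _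
  · exact (continuous_finsetSum _ (fun n _ => PPv_cont _)).intervalIntegrable _ _
  · exact (continuous_finsetSum _ (fun n _ => continuous_const.mul (PPv_cont _))).intervalIntegrable _ _

lemma Q_cont (a : ℝ) : Continuous (fun v : ℝ => Qzeta (1/2 + I * v) a) := by
  have hne : ∀ v : ℝ, (1/2 + I * v : ℂ) ≠ 1 := fun v h => by
    have := congrArg Complex.re h
    simp at this
  have hs : Continuous (fun v : ℝ => (1/2 + I * v : ℂ)) := by fun_prop
  have hH : ∀ b : ℝ, Continuous (fun v : ℝ => hzeta b (1/2 + I * v)) := fun b =>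
    continuous_iff_continuousAt.mpr fun v => ContinuousAt.comp (f := fun v : ℝ => (1/2 + I * v : ℂ))
      (HurwitzZeta.differentiableAt_hurwitzZeta _ (hne v)).continuousAt hs.continuousAt
  have hP : ∀ b : ℝ, Continuous (fun v : ℝ => pzeta b (1/2 + I * v)) := fun b =>
    continuous_iff_continuousAt.mpr fun v => ContinuousAt.comp (f := fun v : ℝ => (1/2 + I * v : ℂ))
      (HurwitzZeta.differentiableAt_expZeta _ _ (Or.inl (hne v))).continuousAt hs.continuousAt
  unfold Qzeta
  exact ((((hH _).add (hH _)).add (hP _)).add (hP _)).div_const _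

lemma cos_id (a : ℝ) : cexp (2 * Real.pi * I * a) + cexp (2 * Real.pi * I * (1 - a : ℝ)) =
    2 * (Real.cos (2 * Real.pi * a) : ℂ) := by
  have : cexp (2 * Real.pi * I * (1 - a : ℝ)) = cexp (-(2 * Real.pi * a) * I) := by
    rw [show (2 * Real.pi * I * (1 - a : ℝ) : ℂ) = -(2 * Real.pi * a) * I + 2 * Real.pi * I by push_cast; ring,
      Complex.exp_add, Complex.exp_two_pi_mul_I, mul_one]
  rw [this, Complex.ofReal_cos, Complex.cos]
  push_cast
  rw [show (2 * Real.pi * I * a : ℂ) = 2 * Real.pi * a * I by ring]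
  ring

set_option maxHeartbeats 1000000

/-- Lower bound for the mean of `|Q(1/2+iv,a)|` over `[t−k, t+k]`. -/
theorem integral_abs_Q_lower_bound (a : ℝ) (ha : 0 < a) (ha' : a ≤ 1 / 2) (hne : a ≠ 1 / 4) :
    ∃ C₁ > (0 : ℝ), ∃ C₂ > (0 : ℝ), ∃ k₀ > (0 : ℝ), ∃ t₀ > (0 : ℝ),
      ∀ k t : ℝ, k₀ ≤ k → t₀ ≤ t → k < t →
        2 * k * |Real.cos (2 * Real.pi * a)| - C₁ - C₂ * k ^ 2 / Real.sqrt (t - k) -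
            ‖Ssum a (min a (1 - a)) k t + Ssum (1 - a) (min a (1 - a)) k t‖ ≤
          ∫ v in (t - k)..(t + k), ‖Qzeta (1 / 2 + Complex.I * v) a‖ := by
  rw [min_eq_left (by linarith : a ≤ 1 - a)]
  obtain ⟨Ca, hCa, Pa⟩ := per_approx a ha ha' a le_rfl (by linarith)
  obtain ⟨Cb, hCb, Pb⟩ := per_approx a ha ha' (1 - a) (by linarith) le_rfl
  let J : ℝ → ℝ := fun x => 2 * (x ^ (-(1/2) : ℝ) / |Real.log x|)
  have hJ : ∀ x, 0 < x → 0 ≤ J x := fun x hx => by simp only [J]; positivity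
  set A : ℝ := 1 / a + 2 with hA
  have hA0 : 0 < A := by positivity
  set B : ℝ := 518 + Real.sqrt (2 * A) + (Ca + Cb) / 2 with hB
  have hB0 : 518 ≤ B := by
    have := Real.sqrt_nonneg (2 * A)
    linarith
  refine ⟨1 + (J a + J (1 + a) + J (1 - a) + J (1 + (1 - a))),
    by linarith [hJ a ha, hJ (1 + a) (by linarith), hJ (1 - a) (by linarith), hJ (1 + (1 - a)) (by linarith)],
    2 * B, by linarith, 1, one_pos, 1, one_pos, ?_⟩
  intro k t hk ht hkt
  have hJs : 0 ≤ J a + J (1 + a) + J (1 - a) + J (1 + (1 - a)) := by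
    linarith [hJ a ha, hJ (1 + a) (by linarith), hJ (1 - a) (by linarith), hJ (1 + (1 - a)) (by linarith)]
  have hx0 : 0 < t - k := by linarith
  have hsx : 0 < Real.sqrt (t - k) := Real.sqrt_pos.mpr hx0
  rcases le_or_gt (Real.sqrt (t - k)) k with hc | hc
  · have h0 : 0 ≤ ∫ v in (t - k)..(t + k), ‖Qzeta (1 / 2 + Complex.I * v) a‖ :=
      intervalIntegral.integral_nonneg (by linarith) (fun _ _ => norm_nonneg _)
    have h1 : 2 * k ≤ 2 * B * k ^ 2 / Real.sqrt (t - k) := by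
      rw [le_div_iff₀ hsx]
      nlinarith [mul_le_mul_of_nonneg_left hc (show 0 ≤ 2 * k by linarith), sq_nonneg k]
    have h2 : 2 * k * |Real.cos (2 * Real.pi * a)| ≤ 2 * k :=
      mul_le_of_le_one_right (by linarith) (Real.abs_cos_le_one _)
    linarith [norm_nonneg (Ssum a a k t + Ssum (1 - a) a k t)]
  have hxk : k ^ 2 < t - k := by
    have := Real.sq_sqrt hx0.le
    nlinarith
  have hxk' : k ≤ t - k := by nlinarith
  have hx1 : 1 ≤ t - k := by linarith
  set N := ⌈t / a⌉₊ with hNd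
  have hN1 : t / a ≤ N := Nat.le_ceil _
  have hN2 : (N : ℝ) < t / a + 1 := Nat.ceil_lt_add_one (by positivity)
  have hNa : t ≤ a * N := by rwa [div_le_iff₀' ha] at hN1
  have hNt : 2 * t ≤ N := by nlinarith [(Nat.cast_nonneg N : (0:ℝ) ≤ N)]
  have hN : 2 ≤ N := by
    have : (2:ℝ) ≤ N := by linarith
    exact_mod_cast this
  have hNA : (N : ℝ) + 1 ≤ (2 * A) * (t - k) := by
    have e : t / a = 1 / a * t := by ring
    have : (N : ℝ) + 1 ≤ A * t := by rw [hA]; nlinarith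
    nlinarith
  have hsN : Real.sqrt (t - k) ≤ Real.sqrt N := Real.sqrt_le_sqrt (by linarith)
  have hpt : ∀ v ∈ Set.uIoc (t - k) (t + k),
      ‖Qzeta (1/2 + I * v) a - (DP a N v + DP (1 - a) N v) / 2‖ ≤ B / Real.sqrt (t - k) := by
    intro v hv
    rw [Set.uIoc_of_le (by linarith)] at hv
    have hv1 : 1 ≤ v := by linarith [hv.1]
    have h1 := hurw_approx a ha (by linarith) v hv1 N hN (by linarith [hv.2])
    have h2 := hurw_approx (1 - a) (by linarith) (by linarith) v hv1 N hN (by linarith [hv.2])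
    have h3 := Pa v hv1 N hN (by linarith [hv.2])
    have h4 := Pb v hv1 N hN (by linarith [hv.2])
    have b1 : 518 / Real.sqrt N + Real.sqrt (N + 1) / v ≤
        518 / Real.sqrt (t - k) + Real.sqrt (2 * A) / Real.sqrt (t - k) := by
      refine add_le_add (by gcongr) ?_
      calc Real.sqrt (N + 1) / v ≤ Real.sqrt ((2 * A) * (t - k)) / (t - k) := by
            gcongr
            exact hv.1.le
        _ = Real.sqrt (2 * A) / Real.sqrt (t - k) := by
            rw [Real.sqrt_mul (by positivity), mul_div_assoc, Real.sqrt_div_self', mul_one_div]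
    have b3 : Ca / Real.sqrt N ≤ Ca / Real.sqrt (t - k) := by gcongr
    have b4 : Cb / Real.sqrt N ≤ Cb / Real.sqrt (t - k) := by gcongr
    have e : Qzeta (1/2 + I * v) a - (DP a N v + DP (1 - a) N v) / 2 =
        ((hzeta a (1/2 + I * v) - ∑ n ∈ Finset.range N, PP (n + a) (1/2 + I * v)) +
        (hzeta (1 - a) (1/2 + I * v) - ∑ n ∈ Finset.range N, PP (n + (1 - a)) (1/2 + I * v)) +
        (pzeta a (1/2 + I * v) - ∑ n ∈ Finset.Ico 1 N, cexp (2 * Real.pi * I * a * n) * PP n (1/2 + I * v)) +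
        (pzeta (1 - a) (1/2 + I * v) - ∑ n ∈ Finset.Ico 1 N,
          cexp (2 * Real.pi * I * (1 - a : ℝ) * n) * PP n (1/2 + I * v))) / 2 := by
      unfold Qzeta DP; ring
    rw [e, norm_div, Complex.norm_ofNat, div_le_iff₀ (by norm_num)]
    refine (norm_add₄_le).trans ?_
    have : B / Real.sqrt (t - k) * 2 = 2 * (518 / Real.sqrt (t - k) + Real.sqrt (2 * A) / Real.sqrt (t - k))
        + Ca / Real.sqrt (t - k) + Cb / Real.sqrt (t - k) := by
      rw [hB]; field_simp; ring
    linarith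
  have hDc : Continuous (fun v : ℝ => (DP a N v + DP (1 - a) N v) / 2) :=
    ((DP_cont _ _).add (DP_cont _ _)).div_const _
  have herr := intervalIntegral.norm_integral_le_of_norm_le_const hpt
  rw [intervalIntegral.integral_sub ((Q_cont a).intervalIntegrable _ _) (hDc.intervalIntegrable _ _),
    intervalIntegral.integral_div, intervalIntegral.integral_add ((DP_cont _ _).intervalIntegrable _ _)
      ((DP_cont _ _).intervalIntegrable _ _), hNd, DP_int a a k t ha hN, DP_int (1 - a) a k t (by linarith) hN,
    show t + k - (t - k) = 2 * k by ring, abs_of_pos (by linarith)] at herr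
  have hQ : ‖∫ v in (t - k)..(t + k), Qzeta (1/2 + I * v) a‖ ≤ ∫ v in (t - k)..(t + k), ‖Qzeta (1 / 2 + I * v) a‖ :=
    intervalIntegral.norm_integral_le_integral_norm (by linarith)
  have herr' : B / Real.sqrt (t - k) * (2 * k) ≤ 2 * B * k ^ 2 / Real.sqrt (t - k) := by
    rw [div_mul_eq_mul_div]
    refine div_le_div_of_nonneg_right ?_ hsx.le
    nlinarith [mul_le_mul_of_nonneg_left hk (show 0 ≤ B * k by nlinarith)]
  have i1 := II_bound a k t ha (Real.log_neg ha (by linarith)).ne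
  have i2 := II_bound (1 + a) k t (by linarith) (Real.log_pos (by linarith)).ne'
  have i3 := II_bound (1 - a) k t (by linarith) (Real.log_neg (by linarith) (by linarith)).ne
  have i4 := II_bound (1 + (1 - a)) k t (by linarith) (Real.log_pos (by linarith)).ne'
  set Q := ∫ v in (t - k)..(t + k), Qzeta (1/2 + I * v) a with hQd
  set E := Q - _ with hE
  have hmain : ((2 * k * Real.cos (2 * Real.pi * a) : ℝ) : ℂ) =
      Q - E - (Ssum a a k t + Ssum (1 - a) a k t) -
        (II a k t + II (1 + a) k t + II (1 - a) k t + II (1 + (1 - a)) k t) / 2 := by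
    rw [hE]
    have := cos_id a
    push_cast at this ⊢
    linear_combination (-(k:ℂ)) * this
  have hn := congrArg norm hmain
  rw [Complex.norm_real, Real.norm_eq_abs, abs_mul, abs_of_pos (show 0 < 2 * k by linarith)] at hn
  have n1 : ‖(II a k t + II (1 + a) k t + II (1 - a) k t + II (1 + (1 - a)) k t) / 2‖ ≤
      J a + J (1 + a) + J (1 - a) + J (1 + (1 - a)) := by
    rw [norm_div, Complex.norm_ofNat]
    have := norm_add₄_le (a := II a k t) (b := II (1 + a) k t) (c := II (1 - a) k t) (d := II (1 + (1 - a)) k t)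
    simp only [J] at hJs ⊢
    linarith
  have n2 := norm_sub_le (Q - E - (Ssum a a k t + Ssum (1 - a) a k t))
    ((II a k t + II (1 + a) k t + II (1 - a) k t + II (1 + (1 - a)) k t) / 2)
  have n3 := norm_sub_le (Q - E) (Ssum a a k t + Ssum (1 - a) a k t)
  have n4 := norm_sub_le Q E
  linarith
end

section
/- Let 0 < a < 1, set a⋆ := min(a, 1−a), and let a_* be either a or 1−a. There exists a positive constant C₃(a_*) such that for every real k and all real A, B with B ≥ A ≥ 2/a⋆, ∫_A^B | Σ_{2 ≤ n < t/a⋆} sin(k·log(n+a_*)) / ((n+a_*)^{1/2+it} · log(n+a_*)) | dt ≤ C₃(a_*)·B, where the constant is independent of k, A, and B. -/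
open Complex MeasureTheory

/-- The sum `Σ_{2 ≤ n < t/amin} sin(k log(n+astar)) / ((n+astar)^{1/2+it} log(n+astar))`. -/
noncomputable def Ssum1 (astar amin k t : ℝ) : ℂ :=
  ∑ n ∈ Finset.Ico 2 ⌈t / amin⌉₊,
    (Real.sin (k * Real.log (n + astar)) : ℂ) /
      (((n : ℝ) + astar : ℝ) ^ ((1 : ℂ) / 2 + Complex.I * t) * (Real.log (n + astar) : ℂ))


lemma aux_osc (A B c θ : ℝ) (hA : A ≤ B) (hc : c ≤ B) (hθ : θ ≠ 0) :
    ‖∫ t in A..B, (Set.Ioi c).indicator (fun t : ℝ => Complex.exp ((Complex.I * θ) * t)) t‖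
      ≤ 2 / |θ| := by
  have h1 : (∫ t in A..B, (Set.Ioi c).indicator
      (fun t : ℝ => Complex.exp ((Complex.I * θ) * t)) t)
      = ∫ t in (max A c)..B, Complex.exp ((Complex.I * θ) * t) := by
    rw [intervalIntegral.integral_of_le hA, intervalIntegral.integral_of_le (max_le hA hc),
      MeasureTheory.setIntegral_indicator measurableSet_Ioi, Set.Ioc_inter_Ioi]
  have hne : Complex.I * (θ : ℂ) ≠ 0 := by
    simp [hθ]
  rw [h1, integral_exp_mul_complex hne, norm_div]
  have h2 : ∀ s : ℝ, ‖Complex.exp (Complex.I * θ * s)‖ = 1 := by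
    intro s
    rw [Complex.norm_exp]; simp
  have h3 : ‖Complex.I * (θ : ℂ)‖ = |θ| := by simp
  rw [h3]
  have h4 := norm_sub_le (Complex.exp (Complex.I * θ * B))
    (Complex.exp (Complex.I * θ * (max A c : ℝ)))
  rw [h2, h2] at h4
  gcongr
  linarith

lemma aux_log (x y : ℝ) (hx : 2 ≤ x) (hxy : x ≤ y) :
    √x * Real.log y ≤ 4 * (√y * Real.log x) := by
  have hl2 := Real.log_two_gt_d9
  have hlx : Real.log 2 ≤ Real.log x := Real.log_le_log (by norm_num) hx
  have hsx : 0 < √x := Real.sqrt_pos.2 (by linarith)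
  have hsxy : √x ≤ √y := Real.sqrt_le_sqrt hxy
  have hsy : 0 < √y := by linarith
  have h1 : Real.log (√y / √x) ≤ √y / √x - 1 := Real.log_le_sub_one_of_pos (by positivity)
  rw [Real.log_div (by positivity) (by positivity), Real.log_sqrt (by linarith),
    Real.log_sqrt (by linarith)] at h1
  have h2 : √x * (√y / √x - 1) = √y - √x := by field_simp
  have h3 : √x * (Real.log y / 2 - Real.log x / 2) ≤ √y - √x := by
    rw [← h2]; gcongr
  nlinarith [mul_le_mul hsxy (le_refl (Real.log x)) (by linarith) (by linarith)]

lemma aux_pair (x y : ℝ) (hx : 2 ≤ x) (hxy : x < y) :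
    (1 / (√x * Real.log x)) * (1 / (√y * Real.log y)) * (1 / (Real.log y - Real.log x)) ≤
      1 / (√x * √y * Real.log 2 ^ 2) + 4 / ((y - x) * Real.log y ^ 2) := by
  have hl2 : 0 < Real.log 2 := Real.log_pos (by norm_num)
  have hlx : Real.log 2 ≤ Real.log x := Real.log_le_log (by norm_num) hx
  have hlxy : Real.log x ≤ Real.log y := Real.log_le_log (by linarith) hxy.le
  have hx0 : 0 < x := by linarith
  have hy0 : 0 < y := by linarith
  have hsx : 0 < √x := Real.sqrt_pos.2 (by linarith)
  have hsy : 0 < √y := Real.sqrt_pos.2 (by linarith)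
  have hlx0 : 0 < Real.log x := by linarith
  have hly0 : 0 < Real.log y := by linarith
  have hd : 0 < y - x := by linarith
  have h1 : (y - x) / y ≤ Real.log y - Real.log x := by
    have := Real.one_sub_inv_le_log_of_pos (x := y / x) (by positivity)
    rw [Real.log_div (by positivity) (by positivity)] at this
    refine le_trans (le_of_eq ?_) this
    field_simp
  have h2 : 1 / (Real.log y - Real.log x) ≤ 1 / ((y - x) / y) := by
    gcongr
  have h3 : 1 / ((y - x) / y) = 1 + x / (y - x) := by field_simp; ring
  rw [h3] at h2
  calc _ ≤ (1 / (√x * Real.log x)) * (1 / (√y * Real.log y)) * (1 + x / (y - x)) := by gcongr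
    _ = 1 / (√x * √y * (Real.log x * Real.log y))
        + (√x * √x) / (√x * √y * Real.log x * Real.log y * (y - x)) := by
      rw [Real.mul_self_sqrt hx0.le]; field_simp
    _ ≤ _ := by
      apply add_le_add
      · rw [pow_two]; gcongr; linarith
      · rw [div_le_div_iff₀ (by positivity) (by positivity)]
        have := aux_log x y hx hxy.le
        have h5 : 0 ≤ √x * (Real.log y * (y - x)) := by positivity
        nlinarith [mul_le_mul_of_nonneg_left this h5]

lemma aux_sqrt_sum (α : ℝ) (hα : 0 < α) (n : ℕ) :
    ∑ m ∈ Finset.Ico 2 n, 1 / √((m : ℝ) + α) ≤ 2 * √(n : ℝ) := by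
  have h : ∑ m ∈ Finset.range n, 1 / √((m : ℝ) + 1) ≤ 2 * √(n : ℝ) := by
    induction n with
    | zero => simp
    | succ k ih =>
      rw [Finset.sum_range_succ]
      push_cast
      have hp : 0 < √((k : ℝ) + 1) := Real.sqrt_pos.2 (by positivity)
      have e1 := Real.sq_sqrt (show (0 : ℝ) ≤ k + 1 by positivity)
      have e2 := Real.sq_sqrt (show (0 : ℝ) ≤ k by positivity)
      have : 1 / √((k : ℝ) + 1) ≤ 2 * √((k : ℝ) + 1) - 2 * √(k : ℝ) := by
        rw [div_le_iff₀ hp]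
        nlinarith [sq_nonneg (√((k : ℝ) + 1) - √(k : ℝ))]
      linarith
  refine le_trans ?_ h
  rcases le_or_gt 2 n with hn | hn
  · have : ∑ m ∈ Finset.Ico 2 n, 1 / √((m : ℝ) + α) ≤
        ∑ m ∈ Finset.Ico 2 n, 1 / √(((m - 1 : ℕ) : ℝ) + 1) := by
      apply Finset.sum_le_sum
      intro m hm
      have hm2 := (Finset.mem_Ico.1 hm).1
      have : 0 < (m : ℝ) := by positivity
      rw [Nat.cast_sub (by omega)]
      apply one_div_le_one_div_of_le
      · apply Real.sqrt_pos.2; simpa using this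
      · apply Real.sqrt_le_sqrt; push_cast; linarith
    refine this.trans ?_
    rw [← Finset.sum_image (g := fun m => m - 1) (f := fun m : ℕ => 1 / √((m : ℝ) + 1))]
    · apply Finset.sum_le_sum_of_subset_of_nonneg
      · intro j hj
        simp only [Finset.mem_image, Finset.mem_Ico] at hj
        obtain ⟨m, hm, rfl⟩ := hj
        simp; omega
      · intros; positivity
    · intro i hi j hj hij
      simp at hi hj hij
      omega
  · rw [Finset.Ico_eq_empty (by omega)]
    simp; positivity

lemma aux_harm_sum (n : ℕ) :
    ∑ m ∈ Finset.Ico 2 n, 1 / ((n : ℝ) - m) ≤ 1 + Real.log n := by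
  have h := harmonic_le_one_add_log n
  refine le_trans ?_ h
  have h2 : ((harmonic n : ℚ) : ℝ) = ∑ m ∈ Finset.range n, 1 / ((n : ℝ) - m) := by
    rw [harmonic, ← Finset.sum_range_reflect]
    push_cast
    apply Finset.sum_congr rfl
    intro j hj
    have := Finset.mem_range.1 hj
    rw [one_div, Nat.sub_sub, Nat.cast_sub (by omega)]
    push_cast; congr 1; ring
  rw [h2]
  apply Finset.sum_le_sum_of_subset_of_nonneg
  · intro j hj; simp at hj ⊢; omega
  · intro j hj _
    have : (j : ℝ) < n := by exact_mod_cast Finset.mem_range.1 hj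
    have : 0 < (n : ℝ) - j := by linarith
    positivity

lemma aux_row (α : ℝ) (hα : 0 < α) (n : ℕ) (hn : 2 ≤ n) :
    ∑ m ∈ Finset.Ico 2 n, (1 / (√((m : ℝ) + α) * Real.log (m + α))) *
      (1 / (√((n : ℝ) + α) * Real.log (n + α))) *
      (1 / (Real.log (n + α) - Real.log (m + α))) ≤ 20 := by
  have hn' : (2 : ℝ) ≤ n := by exact_mod_cast hn
  have hl2 := Real.log_two_gt_d9
  set ly := Real.log ((n : ℝ) + α) with hly
  have hly2 : Real.log 2 ≤ ly := Real.log_le_log (by norm_num) (by linarith)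
  have hlyn : Real.log n ≤ ly := Real.log_le_log (by linarith) (by linarith)
  have hly0 : 0 < ly := by linarith
  have hsy : 0 < √((n : ℝ) + α) := Real.sqrt_pos.2 (by linarith)
  calc _ ≤ ∑ m ∈ Finset.Ico 2 n, (1 / √((m : ℝ) + α) * (1 / (√((n : ℝ) + α) * Real.log 2 ^ 2))
          + 1 / ((n : ℝ) - m) * (4 / ly ^ 2)) := by
        apply Finset.sum_le_sum
        intro m hm
        rw [Finset.mem_Ico] at hm
        have hm2 : (2 : ℝ) ≤ m := by exact_mod_cast hm.1
        have hmn : (m : ℝ) < n := by exact_mod_cast hm.2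
        refine (aux_pair (m + α) (n + α) (by linarith) (by linarith)).trans (le_of_eq ?_)
        rw [← hly]
        congr 1
        · rw [div_mul_div_comm]; ring_nf
        · rw [div_mul_div_comm]; ring_nf
    _ ≤ (2 * √((n : ℝ) + α)) * (1 / (√((n : ℝ) + α) * Real.log 2 ^ 2))
          + (1 + ly) * (4 / ly ^ 2) := by
        rw [Finset.sum_add_distrib, ← Finset.sum_mul, ← Finset.sum_mul]
        have h1 := aux_sqrt_sum α hα n
        have h2 := aux_harm_sum n
        have h3 : √(n : ℝ) ≤ √((n : ℝ) + α) := Real.sqrt_le_sqrt (by linarith)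
        gcongr
        · linarith
        · linarith
    _ = 2 * (1 / Real.log 2) ^ 2 + 4 * (1 / ly) ^ 2 + 4 * (1 / ly) := by
        field_simp
        ring
    _ ≤ 2 * (1.45) ^ 2 + 4 * 1.45 ^ 2 + 4 * 1.45 := by
        have h1 : 1 / Real.log 2 ≤ 1.45 := by
          rw [div_le_iff₀ (by linarith)]; linarith
        have h2 : 1 / ly ≤ 1.45 := by
          rw [div_le_iff₀ (by linarith)]; linarith
        gcongr
    _ ≤ 20 := by norm_num

lemma aux_diag (α : ℝ) (hα : 0 < α) (N : ℕ) :
    ∑ n ∈ Finset.Ico 2 N, (1 / (√((n : ℝ) + α) * Real.log (n + α))) ^ 2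
      ≤ 1 / Real.log (1 + α) := by
  have h0 : 0 < Real.log (1 + α) := Real.log_pos (by linarith)
  rcases le_or_gt 2 N with hN | hN
  swap
  · rw [Finset.Ico_eq_empty (by omega)]; simp; positivity
  have key : ∑ n ∈ Finset.Ico 2 N, (1 / (√((n : ℝ) + α) * Real.log (n + α))) ^ 2
      ≤ 1 / Real.log (1 + α) - 1 / Real.log ((N : ℝ) - 1 + α) := by
    induction N, hN using Nat.le_induction with
    | base => norm_num
    | succ n hn ih =>
      rw [Finset.sum_Ico_succ_top hn]
      have hn' : (2 : ℝ) ≤ n := by exact_mod_cast hn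
      push_cast
      have e : (n : ℝ) + 1 - 1 + α = n + α := by ring
      rw [e]
      set y := (n : ℝ) + α with hy
      have e' : (n : ℝ) - 1 + α = y - 1 := by rw [hy]; ring
      rw [e'] at ih
      have hy1 : 1 < y - 1 := by rw [hy]; linarith
      have hy0 : 0 < y := by linarith
      have hl1 : 0 < Real.log (y - 1) := Real.log_pos hy1
      have hl : Real.log (y - 1) ≤ Real.log y := Real.log_le_log (by linarith) (by linarith)
      have hl' : 0 < Real.log y := by linarith
      have hd : 1 / y ≤ Real.log y - Real.log (y - 1) := by
        have := Real.one_sub_inv_le_log_of_pos (x := y / (y - 1)) (div_pos hy0 (by linarith))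
        rw [Real.log_div (by positivity) (by linarith)] at this
        refine le_trans (le_of_eq ?_) this
        field_simp
        try ring
      have : (1 / (√y * Real.log y)) ^ 2 ≤ 1 / Real.log (y - 1) - 1 / Real.log y := by
        rw [div_pow, mul_pow, Real.sq_sqrt hy0.le]
        calc _ = (1 / y) / (Real.log y * Real.log y) := by field_simp
          _ ≤ (Real.log y - Real.log (y - 1)) / (Real.log (y - 1) * Real.log y) := by
              gcongr
          _ = _ := by field_simp
      linarith
  refine key.trans ?_
  have hN' : (2 : ℝ) ≤ N := by exact_mod_cast hN
  have : 0 < Real.log ((N : ℝ) - 1 + α) := Real.log_pos (by linarith)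
  have : 0 < 1 / Real.log ((N : ℝ) - 1 + α) := by positivity
  linarith

/-- coefficient -/
noncomputable def auxb (α k : ℝ) (n : ℕ) : ℝ :=
  Real.sin (k * Real.log (n + α)) / (√((n : ℝ) + α) * Real.log (n + α))

/-- truncated term -/
noncomputable def auxF (α c k : ℝ) (n : ℕ) (t : ℝ) : ℂ :=
  (Set.Ioi (n * c)).indicator
    (fun t : ℝ => (auxb α k n : ℂ) * Complex.exp (-(Complex.I * Real.log (n + α) * t))) t

lemma auxb_le (α k : ℝ) (hα : 0 < α) (n : ℕ) (hn : 2 ≤ n) :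
    |auxb α k n| ≤ 1 / (√((n : ℝ) + α) * Real.log (n + α)) := by
  have hn' : (2 : ℝ) ≤ n := by exact_mod_cast hn
  have h1 : 0 < Real.log ((n : ℝ) + α) := Real.log_pos (by linarith)
  have h2 : 0 < √((n : ℝ) + α) := Real.sqrt_pos.2 (by linarith)
  rw [auxb, abs_div, abs_of_pos (mul_pos h2 h1)]
  gcongr
  exact Real.abs_sin_le_one _

lemma aux_S (α c k t B : ℝ) (hα : 0 < α) (hc : 0 < c) (ht : t ≤ B) :
    Ssum1 α c k t = ∑ n ∈ Finset.Ico 2 ⌈B / c⌉₊, auxF α c k n t := by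
  have hsub : Finset.Ico 2 ⌈t / c⌉₊ ⊆ Finset.Ico 2 ⌈B / c⌉₊ := by
    apply Finset.Ico_subset_Ico_right
    apply Nat.ceil_mono
    gcongr
  rw [Ssum1, ← Finset.sum_subset hsub]
  · apply Finset.sum_congr rfl
    intro n hn
    rw [Finset.mem_Ico, Nat.lt_ceil, lt_div_iff₀ hc] at hn
    rw [auxF, Set.indicator_of_mem (by exact hn.2)]
    have hx : 0 < (n : ℝ) + α := by positivity
    have hxc : (((n : ℝ) + α : ℝ) : ℂ) ≠ 0 := by exact_mod_cast hx.ne'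
    rw [Complex.cpow_add _ _ hxc, Complex.cpow_def_of_ne_zero hxc (Complex.I * t),
      ← Complex.ofReal_log hx.le]
    have hs : (((n : ℝ) + α : ℝ) : ℂ) ^ ((1 : ℂ) / 2) = ((√((n : ℝ) + α) : ℝ) : ℂ) := by
      rw [Real.sqrt_eq_rpow, Complex.ofReal_cpow hx.le]; norm_num
    rw [hs, Complex.exp_neg, auxb]
    have : Complex.I * (Real.log ((n : ℝ) + α) : ℂ) * t
      = (Real.log ((n : ℝ) + α) : ℂ) * (Complex.I * t) := by ring
    rw [this]
    push_cast
    simp only [div_eq_mul_inv, mul_inv]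
    ring
  · intro n hn hn'
    rw [auxF, Set.indicator_of_notMem]
    intro h
    apply hn'
    rw [Finset.mem_Ico, Nat.lt_ceil, lt_div_iff₀ hc]
    exact ⟨(Finset.mem_Ico.1 hn).1, h⟩

lemma aux_prod (α c k t : ℝ) (hc : 0 < c) (n m : ℕ) :
    auxF α c k n t * (starRingEnd ℂ) (auxF α c k m t) =
      ((auxb α k n * auxb α k m : ℝ) : ℂ) * (Set.Ioi (max (n * c) (m * c))).indicator
        (fun t : ℝ => Complex.exp ((Complex.I *
          ((Real.log (m + α) - Real.log (n + α) : ℝ) : ℂ)) * t)) t := by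
  unfold auxF
  by_cases h1 : n * c < t
  · by_cases h2 : m * c < t
    · rw [Set.indicator_of_mem (by exact h1), Set.indicator_of_mem (by exact h2),
        Set.indicator_of_mem (by exact max_lt h1 h2)]
      rw [map_mul, ← Complex.exp_conj, Complex.conj_ofReal]
      simp only [map_neg, map_mul, Complex.conj_I, Complex.conj_ofReal]
      have : ∀ p q u v w : ℂ, u * v = w → (p * u) * (q * v) = p * q * w := by
        intro p q u v w h; rw [← h]; ring
      push_cast
      apply this
      rw [← Complex.exp_add]
      congr 1
      ring
    · rw [Set.indicator_of_notMem (a := t) (s := Set.Ioi (m * c)) (by exact h2),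
        Set.indicator_of_notMem (a := t) (s := Set.Ioi (max (n * c) (m * c)))
          (by intro h; exact h2 (lt_of_le_of_lt (le_max_right _ _) h))]
      simp
  · rw [Set.indicator_of_notMem (a := t) (s := Set.Ioi (n * c)) (by exact h1),
      Set.indicator_of_notMem (a := t) (s := Set.Ioi (max (n * c) (m * c)))
        (by intro h; exact h1 (lt_of_le_of_lt (le_max_left _ _) h))]
    simp

lemma aux_int (A B c θ : ℝ) : IntervalIntegrable
    ((Set.Ioi c).indicator (fun t : ℝ => Complex.exp ((Complex.I * θ) * t))) volume A B := by
  have h : IntervalIntegrable (fun t : ℝ => Complex.exp ((Complex.I * θ) * t)) volume A B :=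
    Continuous.intervalIntegrable (by fun_prop) _ _
  exact ⟨h.1.indicator measurableSet_Ioi, h.2.indicator measurableSet_Ioi⟩

/-- half kernel -/
noncomputable def auxH (α : ℝ) (n m : ℕ) : ℝ :=
  if m < n then (1 / (√((m : ℝ) + α) * Real.log (m + α))) *
      (1 / (√((n : ℝ) + α) * Real.log (n + α))) *
      (1 / (Real.log (n + α) - Real.log (m + α))) else 0

lemma aux_offdiag (α c k A B : ℝ) (hα : 0 < α) (hA : A ≤ B) (n m : ℕ)
    (hn : 2 ≤ n) (hm : 2 ≤ m) (hmn : m < n) (d : ℝ) (hd : d ≤ B) (θ : ℝ)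
    (hθ : |θ| = Real.log (n + α) - Real.log (m + α)) (b : ℝ)
    (hb : |b| = |auxb α k m| * |auxb α k n|) :
    ‖∫ t in A..B, (b : ℂ) *
      (Set.Ioi d).indicator (fun t : ℝ => Complex.exp ((Complex.I * θ) * t)) t‖
      ≤ 2 * auxH α n m := by
  have hm2 : (2 : ℝ) ≤ m := by exact_mod_cast hm
  have hmn' : (m : ℝ) < n := by exact_mod_cast hmn
  have hl : Real.log (m + α) < Real.log (n + α) := Real.log_lt_log (by linarith) (by linarith)
  have hθ0 : θ ≠ 0 := by
    intro h; rw [h, abs_zero] at hθ; linarith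
  rw [intervalIntegral.integral_const_mul, norm_mul, Complex.norm_real, Real.norm_eq_abs, hb,
    auxH, if_pos hmn]
  have h1 := aux_osc A B d θ hA hd hθ0
  have h2 := auxb_le α k hα n hn
  have h3 := auxb_le α k hα m hm
  rw [hθ] at h1
  have h4 : 0 < Real.log (n + α) - Real.log (m + α) := by linarith
  calc _ ≤ (1 / (√((m : ℝ) + α) * Real.log (m + α))) *
      (1 / (√((n : ℝ) + α) * Real.log (n + α))) *
      (2 / (Real.log (n + α) - Real.log (m + α))) := by
        have h5 := (abs_nonneg _).trans h3
        have h6 := (abs_nonneg _).trans h2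
        gcongr
    _ = _ := by ring

lemma aux_term (α c k A B : ℝ) (hα : 0 < α) (hc : 0 < c) (hA0 : 0 ≤ A) (hA : A ≤ B)
    (n m : ℕ) (hn : n ∈ Finset.Ico 2 ⌈B / c⌉₊) (hm : m ∈ Finset.Ico 2 ⌈B / c⌉₊) :
    ‖∫ t in A..B, auxF α c k n t * (starRingEnd ℂ) (auxF α c k m t)‖ ≤
      2 * auxH α n m + 2 * auxH α m n +
        (if n = m then (1 / (√((n : ℝ) + α) * Real.log (n + α))) ^ 2 * B else 0) := by
  simp only [aux_prod α c k _ hc n m]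
  rw [Finset.mem_Ico, Nat.lt_ceil, lt_div_iff₀ hc] at hn hm
  have hd : max (n * c) (m * c) ≤ B := max_le hn.2.le hm.2.le
  have hm2 : (2 : ℝ) ≤ m := by exact_mod_cast hm.1
  have hn2 : (2 : ℝ) ≤ n := by exact_mod_cast hn.1
  rcases lt_trichotomy m n with h | h | h
  · have hmn' : (m : ℝ) < n := by exact_mod_cast h
    have hl : Real.log (m + α) < Real.log (n + α) := Real.log_lt_log (by linarith) (by linarith)
    have := aux_offdiag α c k A B hα hA n m hn.1 hm.1 h _ hd
      (Real.log (m + α) - Real.log (n + α)) (by rw [abs_of_neg (by linarith)]; ring)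
      (auxb α k n * auxb α k m) (by rw [abs_mul, mul_comm])
    have e1 : auxH α m n = 0 := by rw [auxH, if_neg (by omega)]
    rw [e1, if_neg (by omega)]
    simpa using this
  · subst h
    have e1 : auxH α m m = 0 := by rw [auxH, if_neg (by omega)]
    rw [e1, if_pos rfl]
    have hb := auxb_le α k hα m hm.1
    have : ∀ t ∈ Set.uIoc A B, ‖((auxb α k m * auxb α k m : ℝ) : ℂ) *
        (Set.Ioi (max (m * c) (m * c))).indicator
        (fun t : ℝ => Complex.exp ((Complex.I *
          ((Real.log (m + α) - Real.log (m + α) : ℝ) : ℂ)) * t)) t‖ ≤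
          (1 / (√((m : ℝ) + α) * Real.log (m + α))) ^ 2 := by
      intro t _
      rw [norm_mul, Complex.norm_real, Real.norm_eq_abs, abs_mul]
      have h1 : ‖(Set.Ioi (max (m * c) (m * c))).indicator
        (fun t : ℝ => Complex.exp ((Complex.I *
          ((Real.log (m + α) - Real.log (m + α) : ℝ) : ℂ)) * t)) t‖ ≤ 1 := by
        refine (norm_indicator_le_norm_self _ _).trans ?_
        simp
      calc _ ≤ |auxb α k m| * |auxb α k m| * 1 := by gcongr
        _ = |auxb α k m| ^ 2 := by ring
        _ ≤ _ := by gcongr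
    have h2 := intervalIntegral.norm_integral_le_of_norm_le_const this
    refine h2.trans ?_
    rw [abs_of_nonneg (by linarith)]
    have h3 : 0 ≤ (1 / (√((m : ℝ) + α) * Real.log (m + α))) ^ 2 := by positivity
    nlinarith
  · have hmn' : (n : ℝ) < m := by exact_mod_cast h
    have hl : Real.log (n + α) < Real.log (m + α) := Real.log_lt_log (by linarith) (by linarith)
    have := aux_offdiag α c k A B hα hA m n hm.1 hn.1 h _ hd
      (Real.log (m + α) - Real.log (n + α)) (by rw [abs_of_pos (by linarith)])
      (auxb α k n * auxb α k m) (by rw [abs_mul])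
    have e1 : auxH α n m = 0 := by rw [auxH, if_neg (by omega)]
    rw [e1, if_neg (by omega)]
    simpa using this

lemma aux_H_sum (α : ℝ) (hα : 0 < α) (N : ℕ) :
    ∑ n ∈ Finset.Ico 2 N, ∑ m ∈ Finset.Ico 2 N, auxH α n m ≤ 20 * N := by
  have : ∀ n ∈ Finset.Ico 2 N, ∑ m ∈ Finset.Ico 2 N, auxH α n m ≤ 20 := by
    intro n hn
    rw [Finset.mem_Ico] at hn
    refine le_trans (le_of_eq ?_) (aux_row α hα n hn.1)
    rw [← Finset.sum_subset (Finset.Ico_subset_Ico_right (a := 2) hn.2.le)]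
    · apply Finset.sum_congr rfl
      intro m hm
      rw [auxH, if_pos (Finset.mem_Ico.1 hm).2]
    · intro m hm hm'
      rw [auxH, if_neg]
      intro h
      exact hm' (Finset.mem_Ico.2 ⟨(Finset.mem_Ico.1 hm).1, h⟩)
  refine (Finset.sum_le_sum this).trans ?_
  rw [Finset.sum_const, Nat.card_Ico, nsmul_eq_mul, mul_comm]
  gcongr
  omega

lemma aux_sq (α c k A B : ℝ) (hα : 0 < α) (hc : 0 < c) (hA0 : 0 ≤ A) (hA : A ≤ B) :
    IntervalIntegrable (fun t => ‖Ssum1 α c k t‖ ^ 2) volume A B ∧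
    ∫ t in A..B, ‖Ssum1 α c k t‖ ^ 2 ≤ 80 * (⌈B / c⌉₊ : ℝ) + B / Real.log (1 + α) := by
  set N := ⌈B / c⌉₊ with hN
  have hint : ∀ n m : ℕ, IntervalIntegrable
      (fun t => auxF α c k n t * (starRingEnd ℂ) (auxF α c k m t)) volume A B := by
    intro n m
    simp only [aux_prod α c k _ hc n m]
    exact (aux_int A B _ _).const_mul _
  have heq : ∀ t ∈ Set.uIoc A B, ((‖Ssum1 α c k t‖ ^ 2 : ℝ) : ℂ) =
      ∑ n ∈ Finset.Ico 2 N, ∑ m ∈ Finset.Ico 2 N,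
        auxF α c k n t * (starRingEnd ℂ) (auxF α c k m t) := by
    intro t ht
    rw [Set.uIoc_of_le hA] at ht
    rw [aux_S α c k t B hα hc ht.2, ← hN]
    push_cast
    rw [← Complex.mul_conj', map_sum, Finset.sum_mul_sum]
  have hint2 : IntervalIntegrable (fun t => ∑ n ∈ Finset.Ico 2 N, ∑ m ∈ Finset.Ico 2 N,
        auxF α c k n t * (starRingEnd ℂ) (auxF α c k m t)) volume A B := by
    have := IntervalIntegrable.sum (μ := volume) (a := A) (b := B) (Finset.Ico 2 N)
      (f := fun n => ∑ m ∈ Finset.Ico 2 N, fun t => 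
        auxF α c k n t * (starRingEnd ℂ) (auxF α c k m t))
      (fun n _ => IntervalIntegrable.sum _ (fun m _ => hint n m))
    refine this.congr (fun t _ => ?_)
    simp [Finset.sum_apply]
  have hintc : IntervalIntegrable (fun t => ((‖Ssum1 α c k t‖ ^ 2 : ℝ) : ℂ)) volume A B :=
    hint2.congr (fun t ht => (heq t ht).symm)
  constructor
  · have := hintc
    rw [intervalIntegrable_iff] at this ⊢
    have := this.re
    simpa only [IntegrableOn, RCLike.re_eq_complex_re, Complex.ofReal_re] using this
  have h1 : ((∫ t in A..B, ‖Ssum1 α c k t‖ ^ 2 : ℝ) : ℂ) =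
      ∑ n ∈ Finset.Ico 2 N, ∑ m ∈ Finset.Ico 2 N,
        ∫ t in A..B, auxF α c k n t * (starRingEnd ℂ) (auxF α c k m t) := by
    rw [← intervalIntegral.integral_ofReal,
      intervalIntegral.integral_congr_ae (Filter.Eventually.of_forall heq),
      intervalIntegral.integral_finsetSum]
    · apply Finset.sum_congr rfl
      intro n _
      rw [intervalIntegral.integral_finsetSum]
      intro m _
      exact hint n m
    · intro n _
      have := IntervalIntegrable.sum (μ := volume) (a := A) (b := B) (Finset.Ico 2 N)
        (fun m _ => hint n m)
      refine this.congr (fun t _ => ?_)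
      simp [Finset.sum_apply]
  have h2 : (∫ t in A..B, ‖Ssum1 α c k t‖ ^ 2) ≤
      ‖((∫ t in A..B, ‖Ssum1 α c k t‖ ^ 2 : ℝ) : ℂ)‖ := by
    rw [Complex.norm_real]; exact le_abs_self _
  refine h2.trans ?_
  rw [h1]
  calc _ ≤ ∑ n ∈ Finset.Ico 2 N, ∑ m ∈ Finset.Ico 2 N,
      (2 * auxH α n m + 2 * auxH α m n +
        (if n = m then (1 / (√((n : ℝ) + α) * Real.log (n + α))) ^ 2 * B else 0)) := by
        refine (norm_sum_le _ _).trans (Finset.sum_le_sum fun n hn => ?_)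
        refine (norm_sum_le _ _).trans (Finset.sum_le_sum fun m hm => ?_)
        exact aux_term α c k A B hα hc hA0 hA n m hn hm
    _ = 2 * (∑ n ∈ Finset.Ico 2 N, ∑ m ∈ Finset.Ico 2 N, auxH α n m)
        + 2 * (∑ n ∈ Finset.Ico 2 N, ∑ m ∈ Finset.Ico 2 N, auxH α m n)
        + (∑ n ∈ Finset.Ico 2 N, (1 / (√((n : ℝ) + α) * Real.log (n + α))) ^ 2) * B := by
        simp only [Finset.sum_add_distrib, Finset.mul_sum, Finset.sum_mul]
        congr 1
        apply Finset.sum_congr rfl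
        intro n hn
        rw [Finset.sum_ite_eq, if_pos hn]
    _ ≤ 2 * (20 * N) + 2 * (20 * N) + (1 / Real.log (1 + α)) * B := by
        have := aux_H_sum α hα N
        have e := this
        rw [Finset.sum_comm] at e
        have hB : 0 ≤ B := hA0.trans hA
        have := aux_diag α hα N
        gcongr
    _ = _ := by ring

/-- First moment bound of Lemma 2.2 (first inequality); the constant is independent of
`k`, `A`, `B`. -/
theorem integral_abs_Ssum1_le (a : ℝ) (ha : 0 < a) (ha' : a < 1) (astar : ℝ)
    (hstar : astar = a ∨ astar = 1 - a) :
    ∃ C₃ > (0 : ℝ), ∀ k A B : ℝ, 2 / min a (1 - a) ≤ A → A ≤ B →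
      (∫ t in A..B, ‖Ssum1 astar (min a (1 - a)) k t‖) ≤ C₃ * B := by
  have hα : 0 < astar := by rcases hstar with h | h <;> rw [h] <;> linarith
  have hc : 0 < min a (1 - a) := lt_min ha (by linarith)
  have hc1 : min a (1 - a) < 1 := lt_of_le_of_lt (min_le_left _ _) ha'
  set c := min a (1 - a) with hcdef
  have hl : 0 < Real.log (1 + astar) := Real.log_pos (by linarith)
  refine ⟨1 + 160 / c + 1 / Real.log (1 + astar), by positivity, ?_⟩
  intro k A B hA hAB
  have h2 : 2 ≤ 2 / c := by rw [le_div_iff₀ hc]; linarith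
  obtain ⟨hi, hs⟩ := aux_sq astar c k A B hα hc (by linarith) hAB
  have hB : 2 ≤ B := by linarith
  have hN : (⌈B / c⌉₊ : ℝ) ≤ 2 * (B / c) := by
    have h3 := Nat.ceil_lt_add_one (show 0 ≤ B / c by positivity)
    have : 1 ≤ B / c := by rw [le_div_iff₀ hc]; linarith
    linarith
  have hi2 : IntervalIntegrable (fun t => 1 + ‖Ssum1 astar c k t‖ ^ 2) volume A B :=
    intervalIntegrable_const.add hi
  have h3 : (∫ t in A..B, ‖Ssum1 astar c k t‖) ≤ ∫ t in A..B, (1 + ‖Ssum1 astar c k t‖ ^ 2) := by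
    rw [intervalIntegral.integral_of_le hAB, intervalIntegral.integral_of_le hAB]
    apply MeasureTheory.integral_mono_of_nonneg
    · exact Filter.Eventually.of_forall fun t => norm_nonneg _
    · exact hi2.1
    · refine Filter.Eventually.of_forall fun t => ?_
      show ‖Ssum1 astar c k t‖ ≤ 1 + ‖Ssum1 astar c k t‖ ^ 2
      nlinarith [sq_nonneg (‖Ssum1 astar c k t‖ - 1)]
  rw [intervalIntegral.integral_add intervalIntegrable_const hi] at h3
  simp only [intervalIntegral.integral_const, smul_eq_mul, mul_one] at h3
  have e : (1 + 160 / c + 1 / Real.log (1 + astar)) * B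
      = B + 160 * (B / c) + B / Real.log (1 + astar) := by ring
  rw [e]
  linarith
end
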